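/- arXiv:2510.19339 — 2 statements merged into one kernel-verified Lean document; each statement's English description precedes it below -/
import Mathlib

section
/- Let d ≥ 1 and κ ∈ (0,1). There exists C = C(d,κ) such that the following holds for every p ∈ [1,∞] and all 0 < ε ≤ λ ≤ 1. Let f : ℝ^{d+1} → ℝ be measurable, periodic with respect to (εℤ)^d × (ε²ℤ) (i.e. f(x+εk, t+ε²m) = f(x,t) for all k ∈ ℤ^d, m ∈ ℤ), with vanishing mean over the periodicity cell, ∫_{[0,ε]^d×[0,ε²]} f = 0, and with finite normalized cell norm M_p(f) := ( ε^{−(d+2)} ∫_{[0,ε]^d×[0,ε²]} |f|^p )^{1/p} (with M_∞(f) := ess sup|f|). Then for every z₀ ∈ ℝ^{d+1} and every φ : ℝ^{d+1} → ℝ supported in the parabolic ball {z : |z|_s ≤ 1} with sup|φ| ≤ 1 and sup_{z≠z̄} |φ(z)−φ(z̄)|/|z−z̄|_s^κ ≤ 1, one has |∫_{ℝ^{d+1}} f(z) φ^λ_{z₀}(z) dz| ≤ C (ε/λ)^κ M_p(f). -/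
/-!
**Statement 9** (oscillation estimate, Lemma A.1, case ε ≤ λ, general
p ∈ [1,∞]).

The normalized cell norm `M_p(f) = (ε^{-(d+2)} ∫_{cell} |f|^p)^{1/p}` (with
`M_∞ = ess sup |f|`) is encoded as the `L^p` norm `eLpNorm` with respect to the
normalized measure `ε^{-(d+2)} · volume` restricted to the periodicity cell
`[0,ε]^d × [0,ε²]`.
-/

open MeasureTheory
open scoped ENNReal

noncomputable section

abbrev Pt (d : ℕ) : Type := EuclideanSpace ℝ (Fin d) × ℝ

/-- Parabolic distance `|z - w|_s = |x - x̄| + |t - t̄|^{1/2}`. -/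
def pdist {d : ℕ} (z w : Pt d) : ℝ := ‖z.1 - w.1‖ + Real.sqrt |z.2 - w.2|

/-- The periodicity cell `[0,ε]^d × [0,ε²]`. -/
def cellSet (d : ℕ) (ε : ℝ) : Set (Pt d) :=
  {z : Pt d | (∀ i, z.1 i ∈ Set.Icc 0 ε) ∧ z.2 ∈ Set.Icc 0 (ε ^ 2)}

/-- The normalized cell measure `ε^{-(d+2)} · volume|_{[0,ε]^d × [0,ε²]}`. -/
noncomputable def cellMeas (d : ℕ) (ε : ℝ) : Measure (Pt d) :=
  (ENNReal.ofReal (ε ^ (d + 2)))⁻¹ • volume.restrict (cellSet d ε)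

open scoped Pointwise in
/-- Testing a mean-zero invariant function against a function whose oscillation on each translate
of the fundamental domain is at most `K`. -/
theorem abs_integral_mul_le_of_isAddFundamentalDomain {G α : Type*} [AddGroup G] [AddAction G α]
    [MeasurableSpace α] [Countable G] [MeasurableConstVAdd G α] {μ : Measure α}
    [VAddInvariantMeasure G α μ] {D B : Set α} (hD : IsAddFundamentalDomain G D μ)
    (hDm : MeasurableSet D) (hD0 : μ D ≠ 0) (hDtop : μ D ≠ ⊤) (hB : μ B ≠ ⊤) {f g : α → ℝ}
    (hinv : ∀ (γ : G) (z : α), f (γ +ᵥ z) = f z) (hint : IntegrableOn f D μ)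
    (hmean : ∫ z in D, f z ∂μ = 0) {K : ℝ} (hK : 0 ≤ K)
    (hosc : ∀ (γ : G), ∀ z ∈ D, ∀ w ∈ D, |g (γ +ᵥ z) - g (γ +ᵥ w)| ≤ K)
    (hsupp : ∀ (γ : G), ∀ z ∈ D, g (γ +ᵥ z) ≠ 0 → γ +ᵥ D ⊆ B) :
    |∫ z, f z * g z ∂μ| ≤ K * (∫ z in D, |f z| ∂μ) / μ.real D * μ.real B := by
  have hA : 0 ≤ ∫ z in D, |f z| ∂μ := integral_nonneg fun z => abs_nonneg _
  have hDpos : 0 < μ.real D := ENNReal.toReal_pos hD0 hDtop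
  by_cases hfg : Integrable (fun z => f z * g z) μ
  swap
  · rw [integral_undef hfg, abs_zero]
    positivity
  obtain ⟨w, hw⟩ : D.Nonempty := nonempty_of_measure_ne_zero hD0
  rw [hD.integral_eq_tsum'' _ hfg, ← Real.norm_eq_abs]
  have hsum : HasSum (fun γ : G => μ.real (B ∩ (γ +ᵥ D))) (μ.real B) := by
    have h := hD.measure_eq_tsum' B
    rw [h] at hB
    have := ENNReal.hasSum_toReal hB
    rwa [← ENNReal.tsum_toReal_eq (ENNReal.ne_top_of_tsum_ne_top hB), ← h] at this
  refine tsum_of_norm_bounded (hsum.mul_left _) fun γ => ?_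
  rw [Real.norm_eq_abs]
  simp only [hinv]
  by_cases hz : ∃ z ∈ D, g (γ +ᵥ z) ≠ 0
  swap
  · push Not at hz
    rw [setIntegral_congr_fun hDm (g := fun _ => 0) fun z hzD => by simp [hz z hzD]]
    simp only [integral_zero, abs_zero]
    positivity
  obtain ⟨z, hzD, hz⟩ := hz
  have hBD : μ.real (B ∩ (γ +ᵥ D)) = μ.real D := by
    rw [Set.inter_eq_right.2 (hsupp γ z hzD hz), measureReal_def, measure_vadd, measureReal_def]
  rw [hBD, div_mul_cancel₀ _ hDpos.ne']
  by_cases hi : IntegrableOn (fun z => f z * g (γ +ᵥ z)) D μ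
  swap
  · rw [integral_undef hi, abs_zero]
    positivity
  have hsub : ∫ z in D, f z * g (γ +ᵥ z) ∂μ =
      ∫ z in D, f z * (g (γ +ᵥ z) - g (γ +ᵥ w)) ∂μ := by
    simp only [mul_sub]
    rw [integral_sub hi (hint.mul_const _), integral_mul_const, hmean, zero_mul, sub_zero]
  rw [hsub, ← Real.norm_eq_abs, ← integral_const_mul]
  refine norm_integral_le_of_norm_le (hint.abs.const_mul K)
    ((ae_restrict_iff' hDm).2 (.of_forall fun z hz => ?_))
  rw [Real.norm_eq_abs, abs_mul, mul_comm]
  exact mul_le_mul_of_nonneg_right (hosc γ z hz w hw) (abs_nonneg _)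

/-- The basis of `Pt d` spanning the parabolic lattice `(εℤ)^d × ε²ℤ`. -/
def parabolicBasis (d : ℕ) {ε : ℝ} (hε : 0 < ε) : Module.Basis (Fin d ⊕ Unit) ℝ (Pt d) :=
  ((EuclideanSpace.basisFun (Fin d) ℝ).toBasis.isUnitSMul (w := fun _ => ε)
    fun _ => hε.ne'.isUnit).prod
  ((Module.Basis.singleton Unit ℝ).isUnitSMul (w := fun _ => ε ^ 2)
    fun _ => (pow_pos hε 2).ne'.isUnit)

theorem parabolicBasis_inl {d : ℕ} {ε : ℝ} (hε : 0 < ε) (i : Fin d) :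
    parabolicBasis d hε (Sum.inl i) = (ε • EuclideanSpace.single i 1, 0) := by
  ext <;> simp [parabolicBasis, Module.Basis.isUnitSMul_apply]

theorem parabolicBasis_inr {d : ℕ} {ε : ℝ} (hε : 0 < ε) (u : Unit) :
    parabolicBasis d hε (Sum.inr u) = (0, ε ^ 2) := by
  ext <;> simp [parabolicBasis, Module.Basis.isUnitSMul_apply]

theorem parabolicBasis_repr_inl {d : ℕ} {ε : ℝ} (hε : 0 < ε) (z : Pt d) (i : Fin d) :
    (parabolicBasis d hε).repr z (Sum.inl i) = ε⁻¹ * z.1 i := by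
  simp [parabolicBasis, Module.Basis.repr_isUnitSMul, Units.smul_def]

theorem parabolicBasis_repr_inr {d : ℕ} {ε : ℝ} (hε : 0 < ε) (z : Pt d) (u : Unit) :
    (parabolicBasis d hε).repr z (Sum.inr u) = (ε ^ 2)⁻¹ * z.2 := by
  simp [parabolicBasis, Module.Basis.repr_isUnitSMul, Units.smul_def]

theorem parallelepiped_parabolicBasis {d : ℕ} {ε : ℝ} (hε : 0 < ε) :
    parallelepiped (parabolicBasis d hε) = cellSet d ε := by
  ext z
  have h1 (a : ℝ) : a ∈ Set.Icc 0 ε ↔ ε⁻¹ * a ∈ Set.Icc (0 : ℝ) 1 := by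
    rw [Set.mem_Icc, Set.mem_Icc, inv_mul_le_iff₀ hε, mul_one,
      mul_nonneg_iff_of_pos_left (by positivity)]
  have h2 (a : ℝ) : a ∈ Set.Icc 0 (ε ^ 2) ↔ (ε ^ 2)⁻¹ * a ∈ Set.Icc (0 : ℝ) 1 := by
    rw [Set.mem_Icc, Set.mem_Icc, inv_mul_le_iff₀ (by positivity), mul_one,
      mul_nonneg_iff_of_pos_left (by positivity)]
  rw [parallelepiped_basis_eq]
  simp only [Set.mem_ofPred_eq, cellSet, Sum.forall, parabolicBasis_repr_inl,
    parabolicBasis_repr_inr, h1, h2, forall_const]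

theorem volume_cellSet (d : ℕ) {ε : ℝ} (hε : 0 < ε) :
    volume (cellSet d ε) = ENNReal.ofReal (ε ^ (d + 2)) := by
  have h : cellSet d ε = ((MeasurableEquiv.toLp 2 (Fin d → ℝ)).symm ⁻¹'
      (Set.univ.pi fun _ => Set.Icc 0 ε)) ×ˢ Set.Icc 0 (ε ^ 2) := by
    ext z
    simp [cellSet, -Set.mem_Icc, -Set.pi_univ_Icc]
  rw [h, Measure.volume_eq_prod, Measure.prod_prod,
    (EuclideanSpace.volume_preserving_symm_measurableEquiv_toLp (Fin d)).measure_preimage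
      (MeasurableSet.univ_pi fun _ => measurableSet_Icc).nullMeasurableSet,
    volume_pi_pi]
  simp only [Real.volume_Icc, sub_zero, Finset.prod_const, Finset.card_univ, Fintype.card_fin]
  rw [← ENNReal.ofReal_pow hε.le, ← ENNReal.ofReal_mul (by positivity), pow_add]

theorem isProbabilityMeasure_cellMeas (d : ℕ) {ε : ℝ} (hε : 0 < ε) :
    IsProbabilityMeasure (cellMeas d ε) := by
  refine ⟨?_⟩
  rw [cellMeas, Measure.smul_apply, Measure.restrict_apply_univ, volume_cellSet d hε, smul_eq_mul]
  exact ENNReal.inv_mul_cancel (by simpa using by positivity) ENNReal.ofReal_ne_top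

theorem integrableOn_cellSet_of_eLpNorm_ne_top {d : ℕ} {ε : ℝ} (hε : 0 < ε) {p : ℝ≥0∞}
    (hp : 1 ≤ p) {f : Pt d → ℝ} (hf : Measurable f) (hfp : eLpNorm f p (cellMeas d ε) ≠ ⊤) :
    IntegrableOn f (cellSet d ε) ∧
      (∫ z in cellSet d ε, |f z|) ≤ ε ^ (d + 2) * (eLpNorm f p (cellMeas d ε)).toReal := by
  have := isProbabilityMeasure_cellMeas d hε
  have hpos : 0 < ε ^ (d + 2) := by positivity
  have hc0 : (ENNReal.ofReal (ε ^ (d + 2)))⁻¹ ≠ 0 := by simp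
  have hmem : MemLp f p (cellMeas d ε) := ⟨hf.aestronglyMeasurable, hfp.lt_top⟩
  have hle := eLpNorm_le_eLpNorm_of_exponent_le hp hmem.1
  have hint := hmem.integrable hp
  refine ⟨(integrable_smul_measure hc0 (by simpa using hpos)).1 hint, ?_⟩
  have h := ENNReal.toReal_mono hfp hle
  rw [eLpNorm_one_eq_lintegral_enorm, ← integral_norm_eq_lintegral_enorm hmem.1, cellMeas,
    integral_smul_measure, ENNReal.toReal_inv, ENNReal.toReal_ofReal hpos.le, smul_eq_mul,
    inv_mul_le_iff₀ hpos] at h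
  simpa only [Real.norm_eq_abs, cellMeas] using h

theorem apply_add_of_mem_span_parabolicBasis {d : ℕ} {ε : ℝ} (hε : 0 < ε) {f : Pt d → ℝ}
    (hx : ∀ (z : Pt d) (i : Fin d), f (z.1 + ε • EuclideanSpace.single i 1, z.2) = f z)
    (ht : ∀ z : Pt d, f (z.1, z.2 + ε ^ 2) = f z) {γ : Pt d}
    (hγ : γ ∈ Submodule.span ℤ (Set.range (parabolicBasis d hε))) (z : Pt d) :
    f (γ + z) = f z := by
  let H : AddSubgroup (Pt d) :=
    { carrier := {γ | ∀ z, f (γ + z) = f z}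
      zero_mem' := fun z => by rw [zero_add]
      add_mem' := fun {a b} ha hb z => by rw [add_assoc, ha, hb]
      neg_mem' := fun {a} ha z => by rw [← ha (-a + z), add_neg_cancel_left] }
  have hH : Submodule.span ℤ (Set.range (parabolicBasis d hε)) ≤ AddSubgroup.toIntSubmodule H := by
    rw [Submodule.span_le]
    rintro _ ⟨i | u, rfl⟩ z
    · rw [parabolicBasis_inl, add_comm, ← hx z i, Prod.add_def, add_zero]
    · rw [parabolicBasis_inr, add_comm, ← ht z, Prod.add_def, add_zero]
  exact hH hγ z

theorem norm_sub_le_of_mem_cellSet {d : ℕ} {ε : ℝ} (hε : 0 < ε) {z w : Pt d}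
    (hz : z ∈ cellSet d ε) (hw : w ∈ cellSet d ε) : ‖z.1 - w.1‖ ≤ √d * ε := by
  rw [EuclideanSpace.norm_eq, ← Real.sqrt_sq hε.le, ← Real.sqrt_mul (by positivity)]
  apply Real.sqrt_le_sqrt
  calc ∑ i, ‖(z.1 - w.1) i‖ ^ 2 ≤ ∑ _i : Fin d, ε ^ 2 := by
        refine Finset.sum_le_sum fun i _ => ?_
        rw [Real.norm_eq_abs, sq_abs, PiLp.sub_apply]
        have h1 := hz.1 i
        have h2 := hw.1 i
        exact sq_le_sq' (by linarith [h1.1, h2.2]) (by linarith [h1.2, h2.1])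
    _ = d * ε ^ 2 := by simp

theorem abs_sub_le_of_mem_cellSet {d : ℕ} {ε : ℝ} {z w : Pt d}
    (hz : z ∈ cellSet d ε) (hw : w ∈ cellSet d ε) : |z.2 - w.2| ≤ ε ^ 2 :=
  abs_le.2 ⟨by linarith [hz.2.1, hw.2.2], by linarith [hz.2.2, hw.2.1]⟩

theorem stmt9 (d : ℕ) (hd : 1 ≤ d) (κ : ℝ) (hκ₁ : 0 < κ) (hκ₂ : κ < 1) :
    ∃ C : ℝ, 0 < C ∧
      ∀ p : ℝ≥0∞, 1 ≤ p →
      ∀ ε lam : ℝ, 0 < ε → ε ≤ lam → lam ≤ 1 →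
      ∀ f : Pt d → ℝ,
        Measurable f →
        -- `(εℤ)^d × (ε²ℤ)`-periodic
        (∀ (z : Pt d) (i : Fin d), f (z.1 + ε • EuclideanSpace.single i 1, z.2) = f z) →
        (∀ z : Pt d, f (z.1, z.2 + ε ^ 2) = f z) →
        -- vanishing mean over the periodicity cell
        (∫ z in cellSet d ε, f z) = 0 →
        -- finite normalized cell norm `M_p(f)`
        eLpNorm f p (cellMeas d ε) ≠ ⊤ →
        ∀ (z₀ : Pt d) (φ : Pt d → ℝ),
          -- `φ` supported in the parabolic unit ball ...
          (∀ z : Pt d, 1 < ‖z.1‖ + Real.sqrt |z.2| → φ z = 0) →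
          -- ... with `sup|φ| ≤ 1` and parabolic `κ`-Hölder constant ≤ 1
          (∀ z, |φ z| ≤ 1) →
          (∀ z w, |φ z - φ w| ≤ pdist z w ^ κ) →
          |∫ z : Pt d, f z *
              ((lam ^ (d + 2))⁻¹ * φ (lam⁻¹ • (z.1 - z₀.1), (z.2 - z₀.2) / lam ^ 2))| ≤
            C * (ε / lam) ^ κ * (eLpNorm f p (cellMeas d ε)).toReal := by
  set r : ℝ := 1 + 2 * √d with hr
  set V : ℝ := volume.real (Metric.ball (0 : EuclideanSpace ℝ (Fin d)) 1) with hV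
  have hVpos : 0 < V :=
    ENNReal.toReal_pos (Metric.measure_ball_pos _ _ one_pos).ne' measure_ball_lt_top.ne
  refine ⟨(√d + 1) ^ κ * (r ^ d * V * 6), by positivity, ?_⟩
  intro p hp ε lam hε hεl _ f hf hfx hft hmean hfp z₀ φ hφsupp _ hφ
  have hl : 0 < lam := hε.trans_le hεl
  obtain ⟨hint, hM⟩ := integrableOn_cellSet_of_eLpNorm_ne_top hε hp hf hfp
  set M : ℝ := (eLpNorm f p (cellMeas d ε)).toReal
  set b := parabolicBasis d hε
  have : (volume : Measure (Pt d)).IsAddHaarMeasure :=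
    inferInstanceAs (Measure.prod volume volume).IsAddHaarMeasure
  have hae : ZSpan.fundamentalDomain b =ᵐ[(volume : Measure (Pt d))] cellSet d ε :=
    (ZSpan.fundamentalDomain_ae_parallelepiped b (volume : Measure (Pt d))).trans
      (parallelepiped_parabolicBasis hε).eventuallyEq
  have hsub : ZSpan.fundamentalDomain b ⊆ cellSet d ε :=
    (ZSpan.fundamentalDomain_subset_parallelepiped b).trans
      (parallelepiped_parabolicBasis hε).subset
  have hvolD : volume (ZSpan.fundamentalDomain b) = ENNReal.ofReal (ε ^ (d + 2)) :=
    (measure_congr hae).trans (volume_cellSet d hε)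
  have hpos : 0 < ε ^ (d + 2) := by positivity
  set B : Set (Pt d) := Metric.closedBall z₀.1 (r * lam) ×ˢ Metric.closedBall z₀.2 (3 * lam ^ 2)
  have hvolB : volume B = ENNReal.ofReal (r ^ d * V * 6 * lam ^ (d + 2)) := by
    rw [Measure.volume_eq_prod, Measure.prod_prod, Real.volume_closedBall,
      Measure.addHaar_closedBall _ _ (by positivity), finrank_euclideanSpace_fin,
      ← ENNReal.ofReal_toReal (measure_ball_lt_top (μ := volume)
        (x := (0 : EuclideanSpace ℝ (Fin d))) (r := 1)).ne,
      ← ENNReal.ofReal_mul (by positivity), ← ENNReal.ofReal_mul (by positivity)]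
    congr 1
    rw [← measureReal_def, ← hV, mul_pow]
    ring
  set K : ℝ := (lam ^ (d + 2))⁻¹ * ((√d + 1) * (ε / lam)) ^ κ with hKdef
  have hdist {z w : Pt d} (hz : z ∈ cellSet d ε) (hw : w ∈ cellSet d ε) (γ : Pt d) :
      pdist (d := d) (lam⁻¹ • ((γ + z).1 - z₀.1), ((γ + z).2 - z₀.2) / lam ^ 2)
        (lam⁻¹ • ((γ + w).1 - z₀.1), ((γ + w).2 - z₀.2) / lam ^ 2) ≤ (√d + 1) * (ε / lam) := by
    have h1 : lam⁻¹ • ((γ + z).1 - z₀.1) - lam⁻¹ • ((γ + w).1 - z₀.1) =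
        lam⁻¹ • (z.1 - w.1) := by
      rw [← smul_sub, Prod.fst_add, Prod.fst_add]
      congr 1
      abel
    have h2 : ((γ + z).2 - z₀.2) / lam ^ 2 - ((γ + w).2 - z₀.2) / lam ^ 2 =
        (z.2 - w.2) / lam ^ 2 := by
      rw [Prod.snd_add, Prod.snd_add]
      ring
    have h3 : √|(z.2 - w.2) / lam ^ 2| ≤ ε / lam := by
      refine Real.sqrt_le_iff.2 ⟨by positivity, ?_⟩
      rw [abs_div, abs_of_pos (pow_pos hl 2), div_pow]
      exact div_le_div_of_nonneg_right (abs_sub_le_of_mem_cellSet hz hw) (by positivity)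
    have h4 : lam⁻¹ * ‖z.1 - w.1‖ ≤ lam⁻¹ * (√d * ε) :=
      mul_le_mul_of_nonneg_left (norm_sub_le_of_mem_cellSet hε hz hw) (by positivity)
    rw [pdist, h1, h2, norm_smul, Real.norm_of_nonneg (by positivity)]
    calc _ ≤ lam⁻¹ * (√d * ε) + ε / lam := add_le_add h4 h3
      _ = _ := by ring
  have : Countable (Submodule.span ℤ (Set.range b)).toAddSubgroup :=
    inferInstanceAs (Countable (Submodule.span ℤ (Set.range b)))
  have key := abs_integral_mul_le_of_isAddFundamentalDomain
    (ZSpan.isAddFundamentalDomain' b (volume : Measure (Pt d)))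
    (ZSpan.fundamentalDomain_measurableSet b) (by simpa [hvolD] using hpos)
    (hvolD ▸ ENNReal.ofReal_ne_top) (B := B) (hvolB ▸ ENNReal.ofReal_ne_top) (f := f)
    (g := fun z => (lam ^ (d + 2))⁻¹ * φ (lam⁻¹ • (z.1 - z₀.1), (z.2 - z₀.2) / lam ^ 2))
    (K := K) (fun γ z => apply_add_of_mem_span_parabolicBasis hε hfx hft γ.2 z)
    (hint.mono_set hsub) ((setIntegral_congr_set hae).trans hmean) (by positivity)
    (fun γ z hz w hw => by
      rw [← mul_sub, abs_mul, abs_of_pos (by positivity)]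
      refine mul_le_mul_of_nonneg_left ((hφ _ _).trans ?_) (by positivity)
      exact Real.rpow_le_rpow (add_nonneg (norm_nonneg _) (Real.sqrt_nonneg _))
        (hdist (hsub hz) (hsub hw) γ) hκ₁.le)
    (fun γ z hz hne => by
      have hle : ‖lam⁻¹ • ((γ + z).1 - z₀.1)‖ + √|((γ + z).2 - z₀.2) / lam ^ 2| ≤ 1 := by
        by_contra! h
        exact hne (mul_eq_zero_of_right _ (hφsupp _ h))
      have hx : ‖(γ + z).1 - z₀.1‖ ≤ lam := by
        have := (le_add_of_nonneg_right (Real.sqrt_nonneg _)).trans hle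
        rwa [norm_smul, Real.norm_of_nonneg (by positivity), inv_mul_le_iff₀ hl, mul_one] at this
      have ht : |(γ + z).2 - z₀.2| ≤ lam ^ 2 := by
        have := (le_add_of_nonneg_left (norm_nonneg _)).trans hle
        rwa [Real.sqrt_le_one, abs_div, abs_of_pos (pow_pos hl 2), div_le_one (by positivity)]
          at this
      rintro _ ⟨w, hw, rfl⟩
      have hx' : ‖(γ + w).1 - (γ + z).1‖ ≤ √d * ε := by
        simpa using norm_sub_le_of_mem_cellSet hε (hsub hw) (hsub hz)
      have ht' : |(γ + w).2 - (γ + z).2| ≤ ε ^ 2 := by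
        simpa using abs_sub_le_of_mem_cellSet (hsub hw) (hsub hz)
      have hε2 : ε ^ 2 ≤ lam ^ 2 := by gcongr
      have hd' : √d * ε ≤ √d * lam := by gcongr
      refine ⟨?_, ?_⟩
      · rw [Metric.mem_closedBall, dist_eq_norm]
        calc _ ≤ ‖(γ + w).1 - (γ + z).1‖ + ‖(γ + z).1 - z₀.1‖ :=
              norm_sub_le_norm_sub_add_norm_sub ..
          _ ≤ r * lam := by rw [hr]; nlinarith [Real.sqrt_nonneg d]
      · rw [Metric.mem_closedBall, Real.dist_eq]
        calc _ ≤ |(γ + w).2 - (γ + z).2| + |(γ + z).2 - z₀.2| := abs_sub_le ..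
          _ ≤ 3 * lam ^ 2 := by linarith [sq_nonneg lam])
  refine key.trans ?_
  rw [setIntegral_congr_set hae, measureReal_def, measureReal_def, hvolD, hvolB,
    ENNReal.toReal_ofReal hpos.le, ENNReal.toReal_ofReal (by positivity)]
  calc K * (∫ z in cellSet d ε, |f z|) / ε ^ (d + 2) * (r ^ d * V * 6 * lam ^ (d + 2))
      ≤ K * (ε ^ (d + 2) * M) / ε ^ (d + 2) * (r ^ d * V * 6 * lam ^ (d + 2)) := by gcongr
    _ = _ := by
      rw [hKdef, Real.mul_rpow (by positivity) (by positivity)]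
      field_simp
end
end

section
/- Let d ≥ 1, β ∈ (0, d+2) and R ∈ (0,∞)∖ℕ. There exists C = C(d,β,R) with the following property. Let (K_n)_{n≥1} be functions on ℝ^{d+1} × ℝ^{d+1}, with K_n supported on {(z,z') : |z−z'|_s ≤ 2^{−n}} and such that the second-variable derivatives D₂^r K_n exist and are continuous for all parabolic multi-indices r with |r|_s < R. Define ‖{K_n}‖_{β;0,R} := sup_{n≥1} [ max_{|r|_s<R} 2^{−n(d+2−β+|r|_s)} ‖D₂^r K_n‖_∞ + 2^{−n(d+2−β+R)} sup_{z,w,w'} |K_n(z,w) − P^R_{w'}[K_n(z,·)](w)| / |w−w'|_s^R ] and ⌈{K_n}⌉_{β;R} := max_{|k₁|_s,|k₂|_s<R} sup_{n≥1} sup_{z'} 2^{βn} |∫ (z−z')^{k₁} D₂^{k₂} K_n(z,z') dz| + max_{|k₁|_s<R} sup_{n≥1} sup_{0<|z'−w|_s≤1} 2^{βn} |∫ (z−z')^{k₁} (K_n(z,z') − P^R_w[K_n(z,·)](z')) dz| / |z'−w|_s^R. Then sup_{z₀ ∈ ℝ^{d+1}} sup_{φ ∈ 𝔅_R} sup_{λ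 ∈ (0,1)} λ^{−β} Σ_{n : 2^{−n} < λ} ‖Y^λ_{z₀,n}(φ)‖_{𝔅^{2λ}_R(z₀)} ≤ C ( ‖{K_n}‖_{β;0,R} + ⌈{K_n}⌉_{β;R} ), where Y^λ_{z₀,n}(φ)(w) := ∫ φ^λ_{z₀}(z) K_n(z,w) dz. In other words, the test-function component ⟦{K_n}⟧_{β;R} of the kernel norm of Definition 4.4 is controlled by the scaled sup/Hölder norms together with the integrated (moment) bounds, so that the topology on singular kernels introduced in the paper is weaker than the one of [Sin23]. -/
/-!
**Statement 12** (comparison of kernel norms, Lemma 4.7 of the paper).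

Setup on ℝ^{d+1} with the parabolic scaling: multi-indices `k : Fin (d+1) → ℕ`
with parabolic weight `|k|_s`; for a function `ψ`, `pD k ψ` is its `k`-th
parabolic derivative (an iterated line derivative along coordinate directions)
and `pTaylor R (fun k => pD k ψ w') w w'` is its parabolic Taylor polynomial
`P^R_{w'}[ψ](w)`.  The second-variable derivatives of the kernels `K_n` are
supplied as a family `DK n k` together with the line-derivative compatibility
expressing that they genuinely are the derivatives (they "exist"), and the
hypotheses `hA₁, hA₂` (resp. `hB₁, hB₂`) encode the bound
`‖{K_n}‖_{β;0,R} ≤ A` (resp. `⌈{K_n}⌉_{β;R} ≤ B`).  The conclusion bounds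
`Σ_{n : 2^{-n} < λ} ‖Y^λ_{z₀,n}(φ)‖_{𝔅^{2λ}_R(z₀)} ≤ C (A + B) λ^β`
uniformly over test functions `φ ∈ 𝔅_R` (given with their derivative family
`Dφ`), where the possibly infinite norm `‖·‖_{𝔅^ρ_R(z₀)}` is valued in ℝ≥0∞.
-/

open MeasureTheory
open scoped ENNReal Classical

noncomputable section

abbrev MIdx (d : ℕ) := Fin (d + 1) → ℕ

/-- Parabolic weight `|k|_s = k₁ + ⋯ + k_d + 2 k_{d+1}` of a multi-index. -/
def pw {d : ℕ} (k : MIdx d) : ℕ := (∑ i : Fin d, k i.castSucc) + 2 * k (Fin.last d)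

/-- Monomial `w ↦ w^k = x₁^{k₁} ⋯ x_d^{k_d} t^{k_{d+1}}`. -/
def pmono {d : ℕ} (k : MIdx d) (w : Pt d) : ℝ :=
  (∏ i : Fin d, w.1 i ^ k i.castSucc) * w.2 ^ k (Fin.last d)

/-- Multi-index factorial `k! = k₁! ⋯ k_{d+1}!`. -/
def kfac {d : ℕ} (k : MIdx d) : ℕ := ∏ i, (k i).factorial

/-- The (finite) set of parabolic multi-indices with `|k|_s < γ`. -/
noncomputable def idxSet (d : ℕ) (γ : ℝ) : Finset (MIdx d) :=
  (Fintype.piFinset fun _ : Fin (d + 1) => Finset.range (⌈γ⌉₊ + 1)).filter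
    fun k => (pw k : ℝ) < γ

/-- Coordinate directions of `ℝ^{d+1}`: spatial unit vectors and the time direction. -/
def pdir (d : ℕ) (i : Fin (d + 1)) : Pt d :=
  if h : (i : ℕ) < d then (EuclideanSpace.single (⟨(i : ℕ), h⟩ : Fin d) 1, (0 : ℝ))
  else ((0 : EuclideanSpace ℝ (Fin d)), (1 : ℝ))

/-- Iterated line derivative along a list of directions (head applied outermost). -/
noncomputable def lineDerivIter {P : Type*} [AddCommGroup P] [Module ℝ P]
    (f : P → ℝ) : List P → P → ℝ
  | [], z => f z
  | v :: vs, z => lineDeriv ℝ (fun w => lineDerivIter f vs w) z v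

/-- The parabolic derivative `D^k ψ`. -/
noncomputable def pD {d : ℕ} (k : MIdx d) (ψ : Pt d → ℝ) : Pt d → ℝ :=
  lineDerivIter ψ ((List.finRange (d + 1)).flatMap fun i => List.replicate (k i) (pdir d i))

/-- Parabolic Taylor polynomial `P^R_{w'}` with coefficients `coef k = D^k(·)(w')`,
evaluated at `w`. -/
noncomputable def pTaylor {d : ℕ} (R : ℝ) (coef : MIdx d → ℝ) (w w' : Pt d) : ℝ :=
  ∑ k ∈ idxSet d R, coef k * pmono k (w - w') / (kfac k : ℝ)

/-- The (possibly infinite) norm `‖ψ‖_{𝔅^ρ_R(z₀)}`: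
`max_{|k|_s<R} ρ^{d+2+|k|_s} ‖D^k ψ‖_∞ + ρ^{d+2+R} ‖ψ‖_{C_s^R}` if
`supp ψ ⊂ {|w − z₀|_s ≤ ρ}`, and `∞` otherwise. -/
noncomputable def BnormE {d : ℕ} (R ρ : ℝ) (z₀ : Pt d) (ψ : Pt d → ℝ) : ℝ≥0∞ :=
  if ∀ w : Pt d, ρ < pdist w z₀ → ψ w = 0 then
    (⨆ k ∈ idxSet d R, ⨆ w : Pt d, ENNReal.ofReal (ρ ^ (d + 2 + pw k) * |pD k ψ w|))
      + ⨆ w : Pt d, ⨆ w' : Pt d,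
          ENNReal.ofReal (ρ ^ (((d : ℝ) + 2) + R) *
            (|ψ w - pTaylor R (fun k => pD k ψ w') w w'| / pdist w w' ^ R))
  else ⊤

section Basics

variable {d : ℕ}

theorem pdist_nonneg (z w : Pt d) : 0 ≤ pdist z w := by
  unfold pdist; positivity

theorem pdist_comm (z w : Pt d) : pdist z w = pdist w z := by
  unfold pdist; rw [norm_sub_rev, abs_sub_comm]

theorem pdist_triangle (x y z : Pt d) : pdist x z ≤ pdist x y + pdist y z := by
  unfold pdist
  have h₁ := norm_sub_le_norm_sub_add_norm_sub x.1 y.1 z.1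
  have h₂ : Real.sqrt |x.2 - z.2| ≤ Real.sqrt |x.2 - y.2| + Real.sqrt |y.2 - z.2| := by
    apply Real.sqrt_le_iff.2
    refine ⟨by positivity, ?_⟩
    have h₃ := Real.sq_sqrt (abs_nonneg (x.2 - y.2))
    have h₄ := Real.sq_sqrt (abs_nonneg (y.2 - z.2))
    have h₅ := abs_sub_le x.2 y.2 z.2
    nlinarith [mul_nonneg (Real.sqrt_nonneg |x.2 - y.2|) (Real.sqrt_nonneg |y.2 - z.2|)]
  linarith

theorem continuous_pdist_left (w : Pt d) : Continuous fun z : Pt d => pdist z w := by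
  unfold pdist; fun_prop

theorem pdist_sub_zero (z w : Pt d) : pdist (z - w) 0 = pdist z w := by simp [pdist]

theorem abs_pmono_le (k : MIdx d) (z w : Pt d) : |pmono k (z - w)| ≤ pdist z w ^ pw k := by
  have h₁ : ∀ i, |(z - w).1 i| ≤ pdist z w := fun i => by
    have := PiLp.norm_apply_le (z - w).1 i
    rw [Real.norm_eq_abs] at this
    unfold pdist
    exact this.trans (by simp)
  have h₂ : |(z - w).2| ≤ pdist z w ^ 2 := by
    have h₃ := Real.sq_sqrt (abs_nonneg (z.2 - w.2))
    calc |(z - w).2| = Real.sqrt |z.2 - w.2| ^ 2 := by rw [h₃]; rfl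
      _ ≤ _ := by
        apply pow_le_pow_left₀ (Real.sqrt_nonneg _)
        unfold pdist
        simp
  unfold pmono pw
  rw [abs_mul, Finset.abs_prod, pow_add, ← Finset.prod_pow_eq_pow_sum, pow_mul]
  simp only [abs_pow]
  have := pdist_nonneg z w
  gcongr with i
  exact h₁ i

@[fun_prop]
theorem continuous_pmono (k : MIdx d) : Continuous (pmono k : Pt d → ℝ) := by
  unfold pmono; fun_prop

theorem mem_idxSet {R : ℝ} {k : MIdx d} : k ∈ idxSet d R ↔ (pw k : ℝ) < R := by
  unfold idxSet
  simp only [Finset.mem_filter, Fintype.mem_piFinset, Finset.mem_range, and_iff_right_iff_imp]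
  intro h i
  have h₁ : k i ≤ pw k := by
    unfold pw
    refine Fin.lastCases ?_ (fun i => ?_) i
    · omega
    · have := Finset.single_le_sum (f := fun i : Fin d => k i.castSucc) (fun _ _ => Nat.zero_le _)
        (Finset.mem_univ i)
      omega
  have h₂ : (pw k : ℝ) < ⌈R⌉₊ := h.trans_le (Nat.le_ceil R)
  have : pw k < ⌈R⌉₊ := by exact_mod_cast h₂
  omega

theorem pw_zero : pw (0 : MIdx d) = 0 := by simp [pw]

theorem pw_add (k l : MIdx d) : pw (k + l) = pw k + pw l := by
  simp [pw, Finset.sum_add_distrib]; ring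

theorem one_le_kfac (k : MIdx d) : (1 : ℝ) ≤ kfac k := by
  have : 0 < kfac k := Finset.prod_pos fun i _ => Nat.factorial_pos _
  exact_mod_cast this

theorem zero_mem_idxSet {R : ℝ} (hR : 0 < R) : (0 : MIdx d) ∈ idxSet d R := by
  rw [mem_idxSet, pw_zero, Nat.cast_zero]; exact hR

/-- The parabolic dilation `(x, t) ↦ (r x, r² t)`. -/
def dil (r : ℝ) (z : Pt d) : Pt d := (r • z.1, r ^ 2 * z.2)

theorem pmono_dil (k : MIdx d) (r : ℝ) (z : Pt d) :
    pmono k (dil r z) = r ^ pw k * pmono k z := by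
  simp only [pmono, pw, dil, PiLp.smul_apply, smul_eq_mul, mul_pow, Finset.prod_mul_distrib,
    Finset.prod_pow_eq_pow_sum, pow_add, pow_mul]
  ring

theorem dil_sub (r : ℝ) (z w : Pt d) : dil r (z - w) = dil r z - dil r w := by
  ext <;> simp [dil, mul_sub]

theorem pdist_dil {r : ℝ} (hr : 0 ≤ r) (z w : Pt d) :
    pdist (dil r z) (dil r w) = r * pdist z w := by
  simp only [pdist, dil, ← smul_sub, norm_smul, ← mul_sub, abs_mul, Real.norm_eq_abs,
    abs_of_nonneg hr]
  rw [Real.sqrt_mul (abs_nonneg _), abs_of_nonneg (sq_nonneg r), Real.sqrt_sq hr]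
  ring

theorem dil_zero (r : ℝ) : dil r (0 : Pt d) = 0 := by ext <;> simp [dil]

/-- The point with prescribed coordinates. -/
def toPt (x : Fin (d + 1) → ℝ) : Pt d :=
  (WithLp.toLp 2 fun i => x i.castSucc, x (Fin.last d))

/-- The coordinates of a point. -/
def coords (z : Pt d) : Fin (d + 1) → ℝ := Fin.snoc (fun i => z.1 i) z.2

theorem pmono_eq_prod_coords (k : MIdx d) (z : Pt d) : pmono k z = ∏ i, coords z i ^ k i := by
  simp [Fin.prod_univ_castSucc, coords, pmono]

theorem pmono_toPt (k : MIdx d) (x : Fin (d + 1) → ℝ) : pmono k (toPt x) = ∏ i, x i ^ k i := by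
  simp [Fin.prod_univ_castSucc, toPt, pmono]

theorem coords_add (z w : Pt d) : coords (z + w) = coords z + coords w := by
  ext i
  refine Fin.lastCases ?_ (fun i => ?_) i <;> simp [coords]

theorem pw_le_pw {k l : MIdx d} (h : k ≤ l) : pw k ≤ pw l := by
  unfold pw
  have h₁ := Finset.sum_le_sum fun (i : Fin d) (_ : i ∈ Finset.univ) => h i.castSucc
  have h₂ : k (Fin.last d) ≤ l (Fin.last d) := h (Fin.last d)
  omega

theorem exists_pmono_add_eq {R : ℝ} {l : MIdx d} (hl : l ∈ idxSet d R) (h : Pt d) :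
    ∃ b : MIdx d → ℝ, ∀ z, pmono l (z + h) = ∑ m ∈ idxSet d R, b m * pmono m z := by
  refine ⟨fun m => if m ≤ l then ∏ i, coords h i ^ (l i - m i) * (l i).choose (m i) else 0,
    fun z => ?_⟩
  rw [pmono_eq_prod_coords, coords_add]
  simp only [Pi.add_apply, add_pow]
  rw [Finset.prod_univ_sum]
  refine Finset.sum_subset_zero_on_sdiff (fun m hm => ?_) (fun m hm => ?_) fun m hm => ?_
  · rw [mem_idxSet] at hl ⊢
    have : m ≤ l := fun i => by
      have := Fintype.mem_piFinset.1 hm i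
      simp at this; omega
    have : (pw m : ℝ) ≤ pw l := by exact_mod_cast pw_le_pw this
    linarith
  · rw [Finset.mem_sdiff] at hm
    rw [if_neg, zero_mul]
    intro hle
    refine hm.2 (Fintype.mem_piFinset.2 fun i => ?_)
    have := hle i
    simp; omega
  · rw [if_pos, pmono_eq_prod_coords, ← Finset.prod_mul_distrib]
    · refine Finset.prod_congr rfl fun i _ => by ring
    · intro i
      have := Fintype.mem_piFinset.1 hm i
      simp at this; omega

theorem exists_coeff_eq_sum_eval (d : ℕ) (R : ℝ) :
    ∃ (G : Finset (Pt d)) (α : MIdx d → Pt d → ℝ), ∀ c : MIdx d → ℝ, ∀ l ∈ idxSet d R,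
      c l = ∑ g ∈ G, α l g * ∑ m ∈ idxSet d R, c m * pmono m g := by
  set I := idxSet d R with hI
  obtain ⟨N, hN₀, hN⟩ : ∃ N : ℕ, 0 < N ∧ ∀ m ∈ I, ∀ i, m i < N := by
    refine ⟨⌈R⌉₊ + 1, Nat.succ_pos _, fun m hm i => ?_⟩
    rw [hI, idxSet, Finset.mem_filter] at hm
    exact Finset.mem_range.1 (Fintype.mem_piFinset.1 hm.1 i)
  let S : Finset ℝ := (Finset.range N).image fun n : ℕ => (n : ℝ)
  have hS : S.card = N := by
    rw [Finset.card_image_of_injective _ Nat.cast_injective, Finset.card_range]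
  let G : Finset (Pt d) := (Fintype.piFinset fun _ : Fin (d + 1) => S).image toPt
  let T : (I → ℝ) →ₗ[ℝ] (G → ℝ) :=
    { toFun := fun c g => ∑ m, c m * pmono m.1 g.1
      map_add' := fun c c' => by
        ext g; simp [add_mul, Finset.sum_add_distrib]
      map_smul' := fun r c => by
        ext g; simp [Finset.mul_sum, mul_assoc] }
  have hT : LinearMap.ker T = ⊥ := by
    rw [LinearMap.ker_eq_bot']
    intro c hc
    let P : MvPolynomial (Fin (d + 1)) ℝ :=
      ∑ m : I, MvPolynomial.monomial (Finsupp.equivFunOnFinite.symm m.1) (c m)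
    have hP : P = 0 := by
      refine MvPolynomial.eq_zero_of_eval_zero_at_prod_finset P (fun _ => S) (fun i => ?_)
        fun x hx => ?_
      · rw [hS]
        refine (MvPolynomial.degreeOf_sum_le i _ _).trans_lt ((Finset.sup_lt_iff hN₀).2 ?_)
        intro m _
        by_cases h : c m = 0
        · simpa [h] using hN₀
        · rw [MvPolynomial.degreeOf_monomial_eq _ _ h]
          exact hN m.1 m.2 i
      · have := congrFun hc ⟨toPt x, Finset.mem_image_of_mem _ (Fintype.mem_piFinset.2 hx)⟩
        simpa [P, T, MvPolynomial.eval_monomial, pmono_toPt, Finsupp.prod_fintype] using this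
    ext m
    have := congrArg (MvPolynomial.coeff (Finsupp.equivFunOnFinite.symm m.1)) hP
    simp only [P, MvPolynomial.coeff_sum, MvPolynomial.coeff_monomial, MvPolynomial.coeff_zero] at this
    rw [Finset.sum_eq_single m] at this
    · simpa using this
    · intro m' _ hne
      rw [if_neg]
      intro h
      exact hne (Subtype.ext (Finsupp.equivFunOnFinite.symm.injective h))
    · simp
  obtain ⟨L, hL⟩ := T.exists_leftInverse_of_injective hT
  refine ⟨G, fun l g => if h : l ∈ I ∧ g ∈ G then L (Pi.single ⟨g, h.2⟩ 1) ⟨l, h.1⟩ else 0,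
    fun c l hl => ?_⟩
  have h₁ := congrFun (LinearMap.congr_fun hL fun m => c m.1) ⟨l, hl⟩
  have h₂ : T (fun m => c m.1) = ∑ g : G, (∑ m ∈ I, c m * pmono m g.1) • Pi.single g (1 : ℝ) := by
    ext g
    rw [Finset.sum_apply]
    simp [T, Pi.single_apply, Finset.sum_ite_eq, ← Finset.sum_coe_sort I]
  simp only [LinearMap.comp_apply, LinearMap.id_apply] at h₁
  rw [← h₁, h₂, map_sum, Finset.sum_apply, ← Finset.sum_coe_sort G]
  refine Finset.sum_congr rfl fun g _ => ?_
  rw [map_smul, Pi.smul_apply, smul_eq_mul, mul_comm]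
  simp only [hl, g.2, and_self, dite_true, Subtype.coe_eta]

theorem setOf_pdist_le_subset (w : Pt d) (r : ℝ) :
    {z : Pt d | pdist z w ≤ r} ⊆ Metric.closedBall w.1 r ×ˢ Metric.closedBall w.2 (r ^ 2) := by
  intro z hz
  simp only [Set.mem_ofPred_eq, pdist] at hz
  have h₁ := Real.sqrt_nonneg |z.2 - w.2|
  have h₂ := norm_nonneg (z.1 - w.1)
  refine ⟨?_, ?_⟩
  · rw [Metric.mem_closedBall, dist_eq_norm]; linarith
  · rw [Metric.mem_closedBall, Real.dist_eq, ← Real.sq_sqrt (abs_nonneg (z.2 - w.2))]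
    exact pow_le_pow_left₀ h₁ (by linarith) 2

theorem volume_pdist_le (d : ℕ) :
    ∃ V : ℝ, 0 ≤ V ∧ ∀ (w : Pt d) (r : ℝ), 0 ≤ r →
      volume {z : Pt d | pdist z w ≤ r} ≤ ENNReal.ofReal (V * r ^ (d + 2)) := by
  refine ⟨2 * (volume (Metric.ball (0 : EuclideanSpace ℝ (Fin d)) 1)).toReal, by positivity,
    fun w r hr => ?_⟩
  refine (measure_mono (setOf_pdist_le_subset w r)).trans ?_
  rw [Measure.volume_eq_prod, Measure.prod_prod, Measure.addHaar_closedBall _ _ hr,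
    Real.volume_closedBall]
  obtain ⟨v, hv⟩ : ∃ v, v = volume (Metric.ball (0 : EuclideanSpace ℝ (Fin d)) 1) := ⟨_, rfl⟩
  have hfin : v ≠ ⊤ := by rw [hv]; exact measure_ball_lt_top.ne
  rw [← hv, finrank_euclideanSpace, Fintype.card_fin]
  lift v to NNReal using hfin
  rw [ENNReal.coe_toReal, ← ENNReal.ofReal_coe_nnreal, ← ENNReal.ofReal_mul (by positivity),
    ← ENNReal.ofReal_mul (by positivity)]
  apply le_of_eq
  congr 1
  ring

theorem isCompact_pdist_le (w : Pt d) (r : ℝ) : IsCompact {z : Pt d | pdist z w ≤ r} := by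
  exact ((isCompact_closedBall w.1 r).prod (isCompact_closedBall w.2 (r ^ 2))).of_isClosed_subset
    (isClosed_le (continuous_pdist_left w) continuous_const) (setOf_pdist_le_subset w r)

theorem abs_integral_le_of_support {V : ℝ}
    (hV : ∀ (w : Pt d) (r : ℝ), 0 ≤ r →
      volume {z : Pt d | pdist z w ≤ r} ≤ ENNReal.ofReal (V * r ^ (d + 2))) (hV₀ : 0 ≤ V)
    {g : Pt d → ℝ} {w : Pt d} {r G : ℝ} (hr : 0 ≤ r) (hG : 0 ≤ G)
    (hg : ∀ z, pdist z w ≤ r → |g z| ≤ G) (hs : ∀ z, r < pdist z w → g z = 0) :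
    |∫ z, g z| ≤ G * (V * r ^ (d + 2)) := by
  have hlt : volume {z : Pt d | pdist z w ≤ r} < ⊤ := (hV w r hr).trans_lt ENNReal.ofReal_lt_top
  rw [← setIntegral_eq_integral_of_forall_compl_eq_zero
    (s := {z : Pt d | pdist z w ≤ r}) fun z hz => hs z (not_le.1 hz)]
  refine (norm_setIntegral_le_of_norm_le_const (f := g) hlt (C := G) fun z hz => hg z hz).trans ?_
  gcongr
  exact ENNReal.toReal_le_of_le_ofReal (by positivity) (hV w r hr)

end Basics

section Estimates

variable {d : ℕ}

/-- Size, support, Hölder and moment bounds at scale `ε` for a kernel `D 0` together with its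
derivatives `D k` in the second variable. -/
structure KernelBound (R ε M : ℝ) (D : MIdx d → Pt d → Pt d → ℝ) : Prop where
  cont : ∀ k ∈ idxSet d R, ∀ w, Continuous fun z => D k z w
  supp : ∀ k ∈ idxSet d R, ∀ z w, ε < pdist z w → D k z w = 0
  bound : ∀ k ∈ idxSet d R, ∀ z w, ε ^ (d + 2 + pw k) * |D k z w| ≤ M
  holder : ∀ z w w', ε ^ (d + 2) * ε ^ R *
    |D 0 z w - pTaylor R (fun k => D k z w') w w'| ≤ M * pdist w w' ^ R
  moment : ∀ k₁ ∈ idxSet d R, ∀ k₂ ∈ idxSet d R, ∀ w,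
    |∫ z, pmono k₁ (z - w) * D k₂ z w| ≤ M
  holder_moment : ∀ k ∈ idxSet d R, ∀ w w', 0 < pdist w w' → pdist w w' ≤ 1 →
    |∫ z, pmono k (z - w) * (D 0 z w - pTaylor R (fun k => D k z w') w w')| ≤
      M * pdist w w' ^ R

/-- The function `f` has Taylor coefficients `a k w` and size `Λ` at scale `lam`. -/
structure TestBound (R lam Λ : ℝ) (f : Pt d → ℝ) (a : MIdx d → Pt d → ℝ) : Prop where
  cont : Continuous f
  coeff : ∀ k ∈ idxSet d R, ∀ w, lam ^ pw k * |a k w| ≤ Λ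
  holder : ∀ z w, lam ^ R * |f z - ∑ k ∈ idxSet d R, a k w * pmono k (z - w)| ≤
    Λ * pdist z w ^ R

/-- A constant `V` for which parabolic balls of radius `r` have volume at most `V r^{d+2}`. -/
def IsVolumeBound (d : ℕ) (V : ℝ) : Prop :=
  ∀ (w : Pt d) (r : ℝ), 0 ≤ r →
    volume {z : Pt d | pdist z w ≤ r} ≤ ENNReal.ofReal (V * r ^ (d + 2))

theorem pow_mul_rpow_le {ε θ R : ℝ} {p : ℕ} (hε : 0 < ε) (h : ε ≤ θ) (hp : (p : ℝ) ≤ R) :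
    θ ^ p * ε ^ R ≤ ε ^ p * θ ^ R := by
  have hθ : 0 < θ := hε.trans_le h
  have h₁ : ε ^ R = ε ^ p * ε ^ (R - p) := by
    rw [← Real.rpow_natCast, ← Real.rpow_add hε]; congr 1; ring
  have h₂ : θ ^ R = θ ^ p * θ ^ (R - p) := by
    rw [← Real.rpow_natCast, ← Real.rpow_add hθ]; congr 1; ring
  have h₃ := Real.rpow_le_rpow hε.le h (sub_nonneg.2 hp)
  rw [h₁, h₂]
  calc θ ^ p * (ε ^ p * ε ^ (R - p)) = ε ^ p * (θ ^ p * ε ^ (R - p)) := by ring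
    _ ≤ _ := by gcongr

theorem abs_pTaylor_le (R : ℝ) (coef : MIdx d → ℝ) (w w' : Pt d) :
    |pTaylor R coef w w'| ≤ ∑ k ∈ idxSet d R, pdist w w' ^ pw k * |coef k| := by
  unfold pTaylor
  refine (Finset.abs_sum_le_sum_abs _ _).trans (Finset.sum_le_sum fun k _ => ?_)
  rw [abs_div, abs_mul, Nat.abs_cast, mul_comm]
  refine (div_le_self (by positivity) (one_le_kfac k)).trans ?_
  gcongr
  exact abs_pmono_le k w w'

section

variable {R ε M : ℝ} {D : MIdx d → Pt d → Pt d → ℝ}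

theorem KernelBound.nonneg (hK : KernelBound R ε M D) (hR : 0 < R) : 0 ≤ M :=
  (abs_nonneg _).trans (hK.moment 0 (zero_mem_idxSet hR) 0 (zero_mem_idxSet hR) 0)

theorem KernelBound.integrable (hK : KernelBound R ε M D) {k : MIdx d} (hk : k ∈ idxSet d R)
    {g : Pt d → ℝ} (hg : Continuous g) (w : Pt d) : Integrable fun z => g z * D k z w := by
  refine (hg.mul (hK.cont k hk w)).integrable_of_hasCompactSupport
    (HasCompactSupport.intro (isCompact_pdist_le w ε) fun z hz => ?_)
  rw [Pi.mul_apply, hK.supp k hk z w (not_le.1 hz), mul_zero]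

theorem KernelBound.integral_mul_taylor (hK : KernelBound R ε M D) (hR : 0 < R)
    {g : Pt d → ℝ} (hg : Continuous g) (w w' : Pt d) :
    Integrable (fun z => g z * (D 0 z w - pTaylor R (fun k => D k z w') w w')) ∧
    ∫ z, g z * (D 0 z w - pTaylor R (fun k => D k z w') w w') =
      (∫ z, g z * D 0 z w) - pTaylor R (fun k => ∫ z, g z * D k z w') w w' := by
  have h₀ := hK.integrable (zero_mem_idxSet hR) hg w
  have h₁ : ∀ k ∈ idxSet d R, Integrable fun z =>
      g z * D k z w' * (pmono k (w - w') / kfac k) :=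
    fun k hk => (hK.integrable hk hg w').mul_const _
  have h₂ : ∀ z, g z * (D 0 z w - pTaylor R (fun k => D k z w') w w') =
      g z * D 0 z w - ∑ k ∈ idxSet d R, g z * D k z w' * (pmono k (w - w') / kfac k) := by
    intro z
    rw [mul_sub, pTaylor, Finset.mul_sum]
    congr 1
    exact Finset.sum_congr rfl fun k _ => by ring
  simp only [h₂]
  refine ⟨h₀.sub (integrable_finsetSum _ h₁), ?_⟩
  rw [integral_sub h₀ (integrable_finsetSum _ h₁), integral_finsetSum _ h₁, pTaylor]
  congr 1
  exact Finset.sum_congr rfl fun k _ => by rw [integral_mul_const]; ring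

variable {V : ℝ}

theorem KernelBound.abs_integral_le (hK : KernelBound R ε M D) (hR : 0 < R) (hε : 0 < ε)
    (hV : IsVolumeBound d V) (hV₀ : 0 ≤ V) {k : MIdx d} (hk : k ∈ idxSet d R)
    {g : Pt d → ℝ} {G : ℝ} (hG : 0 ≤ G) {w : Pt d} (hg : ∀ z, pdist z w ≤ ε → |g z| ≤ G) :
    ε ^ pw k * |∫ z, g z * D k z w| ≤ G * M * V := by
  have hM := hK.nonneg hR
  have h := abs_integral_le_of_support hV hV₀ (g := fun z => g z * D k z w) (w := w) (r := ε)
    (G := G * (M / ε ^ (d + 2 + pw k))) hε.le (by positivity)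
    (fun z hz => by
      rw [abs_mul]
      have h₁ := hg z hz
      have h₂ : |D k z w| ≤ M / ε ^ (d + 2 + pw k) := by
        rw [le_div_iff₀ (by positivity), mul_comm]; exact hK.bound k hk z w
      gcongr)
    (fun z hz => by rw [hK.supp k hk z w hz, mul_zero])
  calc ε ^ pw k * |∫ z, g z * D k z w|
      ≤ ε ^ pw k * (G * (M / ε ^ (d + 2 + pw k)) * (V * ε ^ (d + 2))) := by gcongr
    _ = G * M * V := by rw [pow_add]; field_simp

theorem KernelBound.abs_moment_le (hK : KernelBound R ε M D) (hR : 0 < R) (hε : 0 < ε)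
    (hV : IsVolumeBound d V) (hV₀ : 0 ≤ V) {θ : ℝ} (hθ : ε ≤ θ) (hθ₁ : θ ≤ 1)
    {k l : MIdx d} (hk : k ∈ idxSet d R) (hl : l ∈ idxSet d R) (w : Pt d) :
    θ ^ pw k * |∫ z, pmono l (z - w) * D k z w| ≤ M * (1 + V) * θ ^ pw l := by
  have hM := hK.nonneg hR
  have hθ₀ : 0 < θ := hε.trans_le hθ
  rcases le_total (pw k) (pw l) with h | h
  · obtain ⟨p, hp⟩ := Nat.exists_eq_add_of_le h
    have h₁ := hK.abs_integral_le hR hε hV hV₀ hk (g := fun z => pmono l (z - w))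
      (G := ε ^ pw l) (by positivity) (w := w) fun z hz =>
        (abs_pmono_le l z w).trans (pow_le_pow_left₀ (pdist_nonneg _ _) hz _)
    have h₂ : |∫ z, pmono l (z - w) * D k z w| ≤ ε ^ p * M * V := by
      rw [hp, pow_add] at h₁
      have : 0 < ε ^ pw k := by positivity
      refine le_of_mul_le_mul_left (h₁.trans_eq ?_) this
      ring
    have h₃ : ε ^ p ≤ θ ^ p := by gcongr
    calc θ ^ pw k * |∫ z, pmono l (z - w) * D k z w|
        ≤ θ ^ pw k * (θ ^ p * M * V) := by gcongr; exact h₂.trans (by gcongr)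
      _ = M * V * θ ^ pw l := by rw [hp, pow_add]; ring
      _ ≤ M * (1 + V) * θ ^ pw l := by gcongr; linarith
  · have h₁ := hK.moment l hl k hk w
    have h₂ : θ ^ pw k ≤ θ ^ pw l := pow_le_pow_of_le_one hθ₀.le hθ₁ h
    calc θ ^ pw k * |∫ z, pmono l (z - w) * D k z w| ≤ θ ^ pw l * M := by gcongr
      _ = M * 1 * θ ^ pw l := by ring
      _ ≤ M * (1 + V) * θ ^ pw l := by gcongr; linarith

theorem KernelBound.abs_integral_poly_le (hK : KernelBound R ε M D) (hR : 0 < R) (hε : 0 < ε)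
    (hV : IsVolumeBound d V) (hV₀ : 0 ≤ V) {θ : ℝ} (hθ : ε ≤ θ) (hθ₁ : θ ≤ 1)
    {k : MIdx d} (hk : k ∈ idxSet d R) (w : Pt d) {c : MIdx d → ℝ} {E : ℝ}
    (hc : ∀ l ∈ idxSet d R, θ ^ pw l * |c l| ≤ E) :
    θ ^ pw k * |∫ z, (∑ l ∈ idxSet d R, c l * pmono l (z - w)) * D k z w| ≤
      (idxSet d R).card * (M * (1 + V) * E) := by
  have hM := hK.nonneg hR
  have hθ₀ : 0 < θ := hε.trans_le hθ
  have hint : ∀ l ∈ idxSet d R, Integrable fun z => c l * (pmono l (z - w) * D k z w) :=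
    fun l _ => (hK.integrable hk (by fun_prop) w).const_mul _
  have h₁ : ∫ z, (∑ l ∈ idxSet d R, c l * pmono l (z - w)) * D k z w =
      ∑ l ∈ idxSet d R, c l * ∫ z, pmono l (z - w) * D k z w := by
    simp only [Finset.sum_mul, mul_assoc]
    rw [integral_finsetSum _ hint]
    exact Finset.sum_congr rfl fun l _ => integral_const_mul _ _
  rw [h₁, ← nsmul_eq_mul, ← Finset.sum_const]
  refine (mul_le_mul_of_nonneg_left (Finset.abs_sum_le_sum_abs _ _) (by positivity)).trans ?_
  rw [Finset.mul_sum]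
  refine Finset.sum_le_sum fun l hl => ?_
  have h₂ := hK.abs_moment_le hR hε hV hV₀ hθ hθ₁ hk hl w
  have h₃ := hc l hl
  calc θ ^ pw k * |c l * ∫ z, pmono l (z - w) * D k z w|
      = |c l| * (θ ^ pw k * |∫ z, pmono l (z - w) * D k z w|) := by rw [abs_mul]; ring
    _ ≤ |c l| * (M * (1 + V) * θ ^ pw l) := by gcongr
    _ = M * (1 + V) * (θ ^ pw l * |c l|) := by ring
    _ ≤ _ := by gcongr

variable {lam Λ : ℝ} {f : Pt d → ℝ} {a : MIdx d → Pt d → ℝ}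

theorem TestBound.nonneg (hf : TestBound R lam Λ f a) (hR : 0 < R) : 0 ≤ Λ := by
  have := hf.coeff 0 (zero_mem_idxSet hR) 0
  rw [pw_zero, pow_zero, one_mul] at this
  exact (abs_nonneg _).trans this

theorem continuous_poly (c : MIdx d → ℝ) (w : Pt d) :
    Continuous fun z => ∑ k ∈ idxSet d R, c k * pmono k (z - w) := by
  fun_prop

theorem TestBound.abs_integral_remainder_le (hf : TestBound R lam Λ f a)
    (hK : KernelBound R ε M D) (hR : 0 < R) (hε : 0 < ε) (hlam : 0 < lam)
    (hV : IsVolumeBound d V) (hV₀ : 0 ≤ V) {θ : ℝ} (hθ : ε ≤ θ)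
    {k : MIdx d} (hk : k ∈ idxSet d R) (w : Pt d) :
    θ ^ pw k * (lam ^ R *
      |∫ z, (f z - ∑ l ∈ idxSet d R, a l w * pmono l (z - w)) * D k z w|) ≤
      Λ * M * V * θ ^ R := by
  have hM := hK.nonneg hR
  have hΛ := hf.nonneg hR
  have hθ₀ : 0 < θ := hε.trans_le hθ
  have hl : 0 < lam ^ R := Real.rpow_pos_of_pos hlam R
  have heR : 0 < ε ^ R := Real.rpow_pos_of_pos hε R
  have h₁ := hK.abs_integral_le hR hε hV hV₀ hk
    (g := fun z => f z - ∑ l ∈ idxSet d R, a l w * pmono l (z - w)) (G := Λ * ε ^ R / lam ^ R)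
    (by positivity) (w := w) fun z hz => by
      rw [le_div_iff₀ hl, mul_comm]
      refine (hf.holder z w).trans ?_
      have := pdist_nonneg z w
      gcongr
  set J := |∫ z, (f z - ∑ l ∈ idxSet d R, a l w * pmono l (z - w)) * D k z w|
  have h₂ : ε ^ pw k * (lam ^ R * J) ≤ Λ * M * V * ε ^ R := by
    calc ε ^ pw k * (lam ^ R * J) = lam ^ R * (ε ^ pw k * J) := by ring
      _ ≤ lam ^ R * (Λ * ε ^ R / lam ^ R * M * V) := by gcongr
      _ = _ := by field_simp
  have h₃ := pow_mul_rpow_le hε hθ (mem_idxSet.1 hk).le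
  refine le_of_mul_le_mul_left ?_ (by positivity : 0 < ε ^ pw k)
  calc ε ^ pw k * (θ ^ pw k * (lam ^ R * J)) = θ ^ pw k * (ε ^ pw k * (lam ^ R * J)) := by ring
    _ ≤ θ ^ pw k * (Λ * M * V * ε ^ R) := by gcongr
    _ = Λ * M * V * (θ ^ pw k * ε ^ R) := by ring
    _ ≤ Λ * M * V * (ε ^ pw k * θ ^ R) := by gcongr
    _ = _ := by ring

theorem TestBound.abs_integral_le (hf : TestBound R lam Λ f a)
    (hK : KernelBound R ε M D) (hR : 0 < R) (hε : 0 < ε) (hlam : ε ≤ lam) (hlam₁ : lam ≤ 1)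
    (hV : IsVolumeBound d V) (hV₀ : 0 ≤ V) {k : MIdx d} (hk : k ∈ idxSet d R) (w : Pt d) :
    lam ^ pw k * |∫ z, f z * D k z w| ≤ ((idxSet d R).card * (1 + V) + V) * (M * Λ) := by
  have hl₀ : 0 < lam := hε.trans_le hlam
  have hl : 0 < lam ^ R := Real.rpow_pos_of_pos hl₀ R
  have h₁ := hK.abs_integral_poly_le hR hε hV hV₀ hlam hlam₁ hk w (c := fun l => a l w)
    fun l hl => hf.coeff l hl w
  have h₂ := hf.abs_integral_remainder_le hK hR hε hl₀ hV hV₀ hlam hk w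
  have hpc : Continuous fun z => ∑ k ∈ idxSet d R, a k w * pmono k (z - w) := continuous_poly _ _
  have h₃ : ∫ z, f z * D k z w =
      (∫ z, (∑ l ∈ idxSet d R, a l w * pmono l (z - w)) * D k z w) +
      ∫ z, (f z - ∑ l ∈ idxSet d R, a l w * pmono l (z - w)) * D k z w := by
    have hrc : Continuous fun z => f z - ∑ k ∈ idxSet d R, a k w * pmono k (z - w) :=
      hf.cont.sub hpc
    rw [← integral_add (hK.integrable hk hpc w) (hK.integrable hk hrc w)]
    congr 1; ext z; ring
  have h₄ : lam ^ pw k * |∫ z, (f z - ∑ l ∈ idxSet d R, a l w * pmono l (z - w)) * D k z w| ≤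
      Λ * M * V := by
    refine le_of_mul_le_mul_left ?_ hl
    linarith
  rw [h₃]
  refine (mul_le_mul_of_nonneg_left (abs_add_le _ _) (by positivity)).trans ?_
  rw [mul_add]
  linarith

end

end Estimates

section Holder

variable {d : ℕ} {R ε M V lam Λ : ℝ} {D : MIdx d → Pt d → Pt d → ℝ} {f : Pt d → ℝ}
  {a : MIdx d → Pt d → ℝ}

theorem exists_recentred_coeff_bound (d : ℕ) {R : ℝ} (hR : 0 < R) :
    ∃ C : ℝ, 0 ≤ C ∧ ∀ (lam Λ : ℝ) (f : Pt d → ℝ) (a : MIdx d → Pt d → ℝ), 0 < lam →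
      TestBound R lam Λ f a → ∀ w w' : Pt d, ∃ c : MIdx d → ℝ,
        (∀ z, ∑ l ∈ idxSet d R, a l w' * pmono l (z - w') -
          ∑ l ∈ idxSet d R, a l w * pmono l (z - w) =
          ∑ l ∈ idxSet d R, c l * pmono l (z - w')) ∧
        ∀ l ∈ idxSet d R, lam ^ R * (pdist w w' ^ pw l * |c l|) ≤ C * Λ * pdist w w' ^ R := by
  obtain ⟨G, α, hα⟩ := exists_coeff_eq_sum_eval d R
  have hnn : ∀ g : Pt d, 0 ≤ 2 * (1 + pdist g 0) ^ R := fun g => by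
    have := pdist_nonneg g 0
    positivity
  refine ⟨∑ l ∈ idxSet d R, ∑ g ∈ G, |α l g| * (2 * (1 + pdist g 0) ^ R),
    Finset.sum_nonneg fun l _ => Finset.sum_nonneg fun g _ =>
      mul_nonneg (abs_nonneg _) (hnn g), ?_⟩
  intro lam Λ f a hlam hf w w'
  have hΛ := hf.nonneg hR
  have hl : 0 < lam ^ R := Real.rpow_pos_of_pos hlam R
  have hb : ∀ l, ∃ b : MIdx d → ℝ, l ∈ idxSet d R →
      ∀ z, pmono l (z + (w' - w)) = ∑ m ∈ idxSet d R, b m * pmono m z := by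
    intro l
    by_cases h : l ∈ idxSet d R
    · obtain ⟨b, hb⟩ := exists_pmono_add_eq h (w' - w)
      exact ⟨b, fun _ => hb⟩
    · exact ⟨0, fun h' => absurd h' h⟩
  choose b hb using hb
  have hc : ∀ z, ∑ l ∈ idxSet d R, a l w' * pmono l (z - w') -
      ∑ l ∈ idxSet d R, a l w * pmono l (z - w) =
      ∑ l ∈ idxSet d R, (a l w' - ∑ m ∈ idxSet d R, a m w * b m l) * pmono l (z - w') := by
    intro z
    simp only [sub_mul, Finset.sum_sub_distrib]
    congr 1
    simp only [Finset.sum_mul]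
    rw [Finset.sum_comm]
    refine Finset.sum_congr rfl fun l hl => ?_
    have := hb l hl (z - w')
    rw [sub_add_sub_cancel] at this
    rw [this, Finset.mul_sum]
    exact Finset.sum_congr rfl fun m _ => by ring
  refine ⟨_, hc, fun l hl' => ?_⟩
  set c : MIdx d → ℝ := fun l => a l w' - ∑ m ∈ idxSet d R, a m w * b m l
  set δ := pdist w w' with hδ
  have hδ₀ : 0 ≤ δ := pdist_nonneg _ _
  have hval : ∀ g : Pt d,
      lam ^ R * |∑ m ∈ idxSet d R, δ ^ pw m * c m * pmono m g| ≤
        Λ * δ ^ R * (2 * (1 + pdist g 0) ^ R) := by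
    intro g
    have hg := pdist_nonneg g 0
    have h₁ := hc (w' + dil δ g)
    rw [add_sub_cancel_left] at h₁
    have h₂ : ∑ m ∈ idxSet d R, δ ^ pw m * c m * pmono m g =
        (f (w' + dil δ g) - ∑ l ∈ idxSet d R, a l w * pmono l (w' + dil δ g - w)) -
        (f (w' + dil δ g) - ∑ l ∈ idxSet d R, a l w' * pmono l (w' + dil δ g - w')) := by
      rw [sub_sub_sub_cancel_left, add_sub_cancel_left, h₁]
      refine Finset.sum_congr rfl fun m _ => ?_
      rw [pmono_dil]; ring
    have h₃ := hf.holder (w' + dil δ g) w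
    have h₄ := hf.holder (w' + dil δ g) w'
    have h₅ : pdist (w' + dil δ g) w' = δ * pdist g 0 := by
      rw [← pdist_sub_zero, add_sub_cancel_left]
      nth_rewrite 1 [← dil_zero δ]
      exact pdist_dil hδ₀ _ _
    have h₆ : pdist (w' + dil δ g) w ≤ δ * (1 + pdist g 0) := by
      have := pdist_triangle (w' + dil δ g) w' w
      rw [h₅, pdist_comm w' w, ← hδ] at this
      linarith
    have h₇ : pdist (w' + dil δ g) w ^ R ≤ δ ^ R * (1 + pdist g 0) ^ R := by
      rw [← Real.mul_rpow hδ₀ (by positivity)]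
      exact Real.rpow_le_rpow (pdist_nonneg _ _) h₆ hR.le
    have h₈ : pdist (w' + dil δ g) w' ^ R ≤ δ ^ R * (1 + pdist g 0) ^ R := by
      rw [← Real.mul_rpow hδ₀ (by positivity), h₅]
      exact Real.rpow_le_rpow (by positivity) (by gcongr; linarith) hR.le
    rw [h₂]
    calc _ ≤ lam ^ R * (|f (w' + dil δ g) -
            ∑ l ∈ idxSet d R, a l w * pmono l (w' + dil δ g - w)| +
          |f (w' + dil δ g) - ∑ l ∈ idxSet d R, a l w' * pmono l (w' + dil δ g - w')|) := by
          gcongr; exact abs_sub _ _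
      _ ≤ Λ * (δ ^ R * (1 + pdist g 0) ^ R) + Λ * (δ ^ R * (1 + pdist g 0) ^ R) := by
          rw [mul_add]
          refine add_le_add (h₃.trans ?_) (h₄.trans ?_) <;> gcongr
      _ = _ := by ring
  have h₁ := hα (fun m => δ ^ pw m * c m) l hl'
  have h₂ : δ ^ pw l * |c l| = |δ ^ pw l * c l| := by
    rw [abs_mul, abs_of_nonneg (by positivity : 0 ≤ δ ^ pw l)]
  rw [h₂, h₁]
  calc _ ≤ lam ^ R * ∑ g ∈ G, |α l g| * |∑ m ∈ idxSet d R, δ ^ pw m * c m * pmono m g| := by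
        gcongr
        refine (Finset.abs_sum_le_sum_abs _ _).trans_eq ?_
        simp only [abs_mul]
    _ = ∑ g ∈ G, |α l g| * (lam ^ R * |∑ m ∈ idxSet d R, δ ^ pw m * c m * pmono m g|) := by
        rw [Finset.mul_sum]; exact Finset.sum_congr rfl fun g _ => by ring
    _ ≤ ∑ g ∈ G, |α l g| * (Λ * δ ^ R * (2 * (1 + pdist g 0) ^ R)) := by
        exact Finset.sum_le_sum fun g _ => mul_le_mul_of_nonneg_left (hval g) (abs_nonneg _)
    _ = (∑ g ∈ G, |α l g| * (2 * (1 + pdist g 0) ^ R)) * (Λ * δ ^ R) := by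
        rw [Finset.sum_mul]; exact Finset.sum_congr rfl fun g _ => by ring
    _ ≤ (∑ l ∈ idxSet d R, ∑ g ∈ G, |α l g| * (2 * (1 + pdist g 0) ^ R)) * (Λ * δ ^ R) := by
        gcongr
        exact Finset.single_le_sum (f := fun l => ∑ g ∈ G, |α l g| * (2 * (1 + pdist g 0) ^ R))
          (fun l _ => Finset.sum_nonneg fun g _ => mul_nonneg (abs_nonneg _) (hnn g)) hl'
    _ = _ := by ring

/-- Hölder estimate for the remainder of the test function at distances below the scale of the
kernel. -/
theorem TestBound.abs_remainder_le_of_le (hf : TestBound R lam Λ f a)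
    (hK : KernelBound R ε M D) (hR : 0 < R) (hε : 0 < ε) (hlam : 0 < lam)
    (hV : IsVolumeBound d V) (hV₀ : 0 ≤ V) {w w' : Pt d} (hw : pdist w w' ≤ ε) :
    lam ^ R * |∫ z, (f z - ∑ l ∈ idxSet d R, a l w * pmono l (z - w)) *
        (D 0 z w - pTaylor R (fun k => D k z w') w w')| ≤
      2 ^ R * 2 ^ (d + 2) * V * (M * Λ) * pdist w w' ^ R := by
  have hM := hK.nonneg hR
  have hΛ := hf.nonneg hR
  have hl : 0 < lam ^ R := Real.rpow_pos_of_pos hlam R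
  have heR : 0 < ε ^ R := Real.rpow_pos_of_pos hε R
  have hδ₀ := pdist_nonneg w w'
  set δ := pdist w w' with hδ
  have h := abs_integral_le_of_support hV hV₀ (w := w) (r := 2 * ε)
    (g := fun z => (f z - ∑ l ∈ idxSet d R, a l w * pmono l (z - w)) *
        (D 0 z w - pTaylor R (fun k => D k z w') w w'))
    (G := Λ * (2 * ε) ^ R / lam ^ R * (M * δ ^ R / (ε ^ (d + 2) * ε ^ R)))
    (by positivity) (by positivity)
    (fun z hz => by
      rw [abs_mul]
      have h₁ : |f z - ∑ l ∈ idxSet d R, a l w * pmono l (z - w)| ≤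
          Λ * (2 * ε) ^ R / lam ^ R := by
        rw [le_div_iff₀ hl, mul_comm]
        refine (hf.holder z w).trans ?_
        have := pdist_nonneg z w
        gcongr
      have h₂ : |D 0 z w - pTaylor R (fun k => D k z w') w w'| ≤
          M * δ ^ R / (ε ^ (d + 2) * ε ^ R) := by
        rw [le_div_iff₀ (by positivity), mul_comm]; exact hK.holder z w w'
      gcongr)
    (fun z hz => by
      have h₁ : ε < pdist z w := by linarith
      have h₂ : ε < pdist z w' := by
        have := pdist_triangle z w' w
        rw [pdist_comm w' w, ← hδ] at this
        linarith
      have h₃ : pTaylor R (fun k => D k z w') w w' = 0 := by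
        unfold pTaylor
        refine Finset.sum_eq_zero fun k hk => ?_
        simp only [hK.supp k hk z w' h₂, zero_mul, zero_div]
      rw [hK.supp 0 (zero_mem_idxSet hR) z w h₁, h₃, sub_zero, mul_zero])
  refine (mul_le_mul_of_nonneg_left h hl.le).trans_eq ?_
  rw [Real.mul_rpow (by norm_num) hε.le, mul_pow]
  field_simp

/-- Hölder estimate for the remainder of the test function at distances above the scale of the
kernel. -/
theorem TestBound.abs_remainder_le_of_ge (hf : TestBound R lam Λ f a)
    (hK : KernelBound R ε M D) (hR : 0 < R) (hε : 0 < ε) (hlam : 0 < lam)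
    (hV : IsVolumeBound d V) (hV₀ : 0 ≤ V) {w w' : Pt d} (hw : ε ≤ pdist w w')
    (hw₁ : pdist w w' ≤ 1) {C : ℝ} {c : MIdx d → ℝ}
    (hc : ∀ z, ∑ l ∈ idxSet d R, a l w' * pmono l (z - w') -
          ∑ l ∈ idxSet d R, a l w * pmono l (z - w) =
          ∑ l ∈ idxSet d R, c l * pmono l (z - w'))
    (hc' : ∀ l ∈ idxSet d R, lam ^ R * (pdist w w' ^ pw l * |c l|) ≤ C * Λ * pdist w w' ^ R) :
    lam ^ R * |∫ z, (f z - ∑ l ∈ idxSet d R, a l w * pmono l (z - w)) *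
        (D 0 z w - pTaylor R (fun k => D k z w') w w')| ≤
      (V + (idxSet d R).card * (V + (idxSet d R).card * (1 + V) * C)) * (M * Λ) *
        pdist w w' ^ R := by
  have hM := hK.nonneg hR
  have hΛ := hf.nonneg hR
  have hl : 0 < lam ^ R := Real.rpow_pos_of_pos hlam R
  have hδ₀ := pdist_nonneg w w'
  set δ := pdist w w' with hδ
  have hpc : ∀ w, Continuous fun z => ∑ k ∈ idxSet d R, a k w * pmono k (z - w) :=
    fun w => continuous_poly _ _
  have hcc : Continuous fun z => ∑ k ∈ idxSet d R, c k * pmono k (z - w') :=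
    continuous_poly _ _
  have hrc : ∀ w, Continuous fun z => f z - ∑ k ∈ idxSet d R, a k w * pmono k (z - w) :=
    fun w => hf.cont.sub (hpc w)
  rw [(hK.integral_mul_taylor hR (hrc w) w w').2]
  have h₀ := hf.abs_integral_remainder_le hK hR hε hlam hV hV₀ hw (zero_mem_idxSet hR) w
  rw [pw_zero, pow_zero, one_mul] at h₀
  have hk : ∀ k ∈ idxSet d R, lam ^ R * (δ ^ pw k *
      |∫ z, (f z - ∑ l ∈ idxSet d R, a l w * pmono l (z - w)) * D k z w'|) ≤
      (V + (idxSet d R).card * (1 + V) * C) * (M * Λ) * δ ^ R := by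
    intro k hk
    have h₁ := hf.abs_integral_remainder_le hK hR hε hlam hV hV₀ hw hk w'
    have h₂ := hK.abs_integral_poly_le hR hε hV hV₀ hw hw₁ hk w' (c := c)
      (E := C * Λ * δ ^ R / lam ^ R) fun l hl' => by
        rw [le_div_iff₀ hl, mul_comm]; exact hc' l hl'
    have h₃ : ∫ z, (f z - ∑ l ∈ idxSet d R, a l w * pmono l (z - w)) * D k z w' =
        (∫ z, (f z - ∑ l ∈ idxSet d R, a l w' * pmono l (z - w')) * D k z w') +
        ∫ z, (∑ l ∈ idxSet d R, c l * pmono l (z - w')) * D k z w' := by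
      rw [← integral_add (hK.integrable hk (hrc w') w') (hK.integrable hk hcc w')]
      congr 1; ext z; rw [← hc]; ring
    rw [h₃]
    calc _ ≤ lam ^ R * (δ ^ pw k *
          (|∫ z, (f z - ∑ l ∈ idxSet d R, a l w' * pmono l (z - w')) * D k z w'| +
          |∫ z, (∑ l ∈ idxSet d R, c l * pmono l (z - w')) * D k z w'|)) := by
          gcongr; exact abs_add_le _ _
      _ = δ ^ pw k * (lam ^ R *
          |∫ z, (f z - ∑ l ∈ idxSet d R, a l w' * pmono l (z - w')) * D k z w'|) + lam ^ R *
          (δ ^ pw k * |∫ z, (∑ l ∈ idxSet d R, c l * pmono l (z - w')) * D k z w'|) := by ring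
      _ ≤ Λ * M * V * δ ^ R + lam ^ R * ((idxSet d R).card *
          (M * (1 + V) * (C * Λ * δ ^ R / lam ^ R))) := by gcongr
      _ = _ := by field_simp
  have hT := abs_pTaylor_le R (fun k =>
    ∫ z, (f z - ∑ l ∈ idxSet d R, a l w * pmono l (z - w)) * D k z w') w w'
  have hT' : lam ^ R * |pTaylor R (fun k =>
      ∫ z, (f z - ∑ l ∈ idxSet d R, a l w * pmono l (z - w)) * D k z w') w w'| ≤
      (idxSet d R).card * ((V + (idxSet d R).card * (1 + V) * C) * (M * Λ) * δ ^ R) := by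
    refine (mul_le_mul_of_nonneg_left hT hl.le).trans ?_
    rw [Finset.mul_sum, ← nsmul_eq_mul, ← Finset.sum_const]
    exact Finset.sum_le_sum hk
  refine (mul_le_mul_of_nonneg_left (abs_sub _ _) hl.le).trans ?_
  rw [mul_add]
  linarith

theorem exists_holder_bound (d : ℕ) {R : ℝ} (hR : 0 < R) :
    ∃ C : ℝ, 0 ≤ C ∧ ∀ (ε M lam Λ : ℝ) (D : MIdx d → Pt d → Pt d → ℝ) (f : Pt d → ℝ)
      (a : MIdx d → Pt d → ℝ), 0 < ε → ε ≤ lam → lam ≤ 1 → KernelBound R ε M D →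
      TestBound R lam Λ f a →
      (∀ k ∈ idxSet d R, ∀ w, lam ^ pw k * |∫ z, f z * D k z w| ≤ C * (M * Λ)) ∧
      ∀ w w', 0 < pdist w w' →
        lam ^ R * |(∫ z, f z * D 0 z w) - pTaylor R (fun k => ∫ z, f z * D k z w') w w'| ≤
          C * (M * Λ) * pdist w w' ^ R := by
  obtain ⟨V, hV₀, hV⟩ := volume_pdist_le d
  obtain ⟨Cg, hCg, hg⟩ := exists_recentred_coeff_bound d hR
  set N : ℝ := ((idxSet d R).card : ℝ) with hN
  have hN₀ : 0 ≤ N := Nat.cast_nonneg _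
  set C₁ := N * (1 + V) + V with hC₁
  set C₂ := 2 ^ R * 2 ^ (d + 2) * V with hC₂
  set C₃ := V + N * (V + N * (1 + V) * Cg) with hC₃
  have hC₁₀ : 0 ≤ C₁ := by positivity
  have hC₂₀ : 0 ≤ C₂ := by positivity
  have hC₃₀ : 0 ≤ C₃ := by positivity
  refine ⟨(C₁ + N * C₁) + (N + C₂ + C₃), by positivity, ?_⟩
  intro ε M lam Λ D f a hε hεl hl₁ hK hf
  have hM := hK.nonneg hR
  have hΛ := hf.nonneg hR
  have hl₀ : 0 < lam := hε.trans_le hεl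
  have hl : 0 < lam ^ R := Real.rpow_pos_of_pos hl₀ R
  have hpt : ∀ k ∈ idxSet d R, ∀ w, lam ^ pw k * |∫ z, f z * D k z w| ≤ C₁ * (M * Λ) :=
    fun k hk w => hf.abs_integral_le hK hR hε hεl hl₁ hV hV₀ hk w
  refine ⟨fun k hk w => (hpt k hk w).trans ?_, fun w w' hδ₀ => ?_⟩
  · have : 0 ≤ N * C₁ + (N + C₂ + C₃) := by positivity
    gcongr; linarith
  rcases le_or_gt lam (pdist w w') with hlδ | hδl
  · set δ := pdist w w' with hδ
    have h₁ : ∀ k ∈ idxSet d R, ∀ w, lam ^ R * (δ ^ pw k * |∫ z, f z * D k z w|) ≤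
        C₁ * (M * Λ) * δ ^ R := by
      intro k hk w
      refine le_of_mul_le_mul_left ?_ (by positivity : 0 < lam ^ pw k)
      have h₂ := pow_mul_rpow_le hl₀ hlδ (mem_idxSet.1 hk).le
      calc lam ^ pw k * (lam ^ R * (δ ^ pw k * |∫ z, f z * D k z w|))
          = (δ ^ pw k * lam ^ R) * (lam ^ pw k * |∫ z, f z * D k z w|) := by ring
        _ ≤ (lam ^ pw k * δ ^ R) * (C₁ * (M * Λ)) := by gcongr ?_ * ?_; exact hpt k hk w
        _ = _ := by ring
    have h₂ := h₁ 0 (zero_mem_idxSet hR) w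
    rw [pw_zero, pow_zero, one_mul] at h₂
    have h₃ : lam ^ R * |pTaylor R (fun k => ∫ z, f z * D k z w') w w'| ≤
        N * (C₁ * (M * Λ) * δ ^ R) := by
      refine (mul_le_mul_of_nonneg_left (abs_pTaylor_le _ _ _ _) hl.le).trans ?_
      rw [Finset.mul_sum, hN, ← nsmul_eq_mul, ← Finset.sum_const]
      exact Finset.sum_le_sum fun k hk => h₁ k hk w'
    have h₄ : 0 ≤ (N + C₂ + C₃) * (M * Λ) * δ ^ R := by positivity
    refine (mul_le_mul_of_nonneg_left (abs_sub _ _) hl.le).trans ?_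
    linarith
  · have hδ₁ : pdist w w' ≤ 1 := by linarith
    have hpc : Continuous fun z => ∑ k ∈ idxSet d R, a k w * pmono k (z - w) :=
      continuous_poly _ _
    have hrc : Continuous fun z => f z - ∑ k ∈ idxSet d R, a k w * pmono k (z - w) :=
      hf.cont.sub hpc
    rw [← (hK.integral_mul_taylor hR hf.cont w w').2]
    set δ := pdist w w' with hδ
    set F : Pt d → ℝ := fun z => D 0 z w - pTaylor R (fun k => D k z w') w w' with hF
    have hsplit : ∫ z, f z * F z =
        (∫ z, (∑ k ∈ idxSet d R, a k w * pmono k (z - w)) * F z) +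
        ∫ z, (f z - ∑ k ∈ idxSet d R, a k w * pmono k (z - w)) * F z := by
      rw [← integral_add (hK.integral_mul_taylor hR hpc w w').1
        (hK.integral_mul_taylor hR hrc w w').1]
      congr 1; ext z; ring
    have h₁ : lam ^ R * |∫ z, (∑ k ∈ idxSet d R, a k w * pmono k (z - w)) * F z| ≤
        N * (Λ * (M * δ ^ R)) := by
      have hint : ∀ k ∈ idxSet d R, Integrable fun z => a k w * (pmono k (z - w) * F z) :=
        fun k _ => (hK.integral_mul_taylor hR
          (by fun_prop : Continuous fun z => pmono k (z - w)) w w').1.const_mul _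
      simp only [Finset.sum_mul, mul_assoc]
      rw [integral_finsetSum _ hint, hN, ← nsmul_eq_mul, ← Finset.sum_const]
      refine (mul_le_mul_of_nonneg_left (Finset.abs_sum_le_sum_abs _ _) hl.le).trans ?_
      rw [Finset.mul_sum]
      refine Finset.sum_le_sum fun k hk => ?_
      rw [integral_const_mul, abs_mul, ← mul_assoc]
      have h₂ : lam ^ R * |a k w| ≤ Λ := by
        refine le_trans ?_ (hf.coeff k hk w)
        gcongr
        rw [← Real.rpow_natCast]
        exact Real.rpow_le_rpow_of_exponent_ge hl₀ hl₁ (mem_idxSet.1 hk).le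
      have h₃ := hK.holder_moment k hk w w' hδ₀ hδ₁
      gcongr
    have h₂ : lam ^ R * |∫ z, (f z - ∑ k ∈ idxSet d R, a k w * pmono k (z - w)) * F z| ≤
        (C₂ + C₃) * (M * Λ) * δ ^ R := by
      rcases le_total δ ε with h | h
      · refine (hf.abs_remainder_le_of_le hK hR hε hl₀ hV hV₀ h).trans ?_
        gcongr; linarith
      · obtain ⟨c, hc, hc'⟩ := hg lam Λ f a hl₀ hf w w'
        refine (hf.abs_remainder_le_of_ge hK hR hε hl₀ hV hV₀ h hδ₁ hc hc').trans ?_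
        have : 0 ≤ C₂ * (M * Λ) * δ ^ R := by positivity
        linarith
    have h₄ : 0 ≤ (C₁ + N * C₁) * (M * Λ) * δ ^ R := by positivity
    rw [hsplit]
    refine (mul_le_mul_of_nonneg_left (abs_add_le _ _) hl.le).trans ?_
    linarith

end Holder

section Derivatives

variable {d : ℕ}

theorem midx_induction {p : MIdx d → Prop} (h₀ : p 0)
    (h : ∀ k j, p k → p (k + Pi.single j 1)) (k : MIdx d) : p k := by
  have hs : ∀ (s : Finset (Fin (d + 1))) (n : Fin (d + 1) → ℕ),
      p (∑ j ∈ s, n j • Pi.single j 1) := by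
    intro s n
    induction s using Finset.induction_on with
    | empty => simpa using h₀
    | insert j s hj ih =>
      rw [Finset.sum_insert hj, add_comm]
      induction n j with
      | zero => simpa using ih
      | succ m ihm => rw [succ_nsmul, ← add_assoc]; exact h _ _ ihm
  convert hs Finset.univ k
  ext i
  simp [Finset.sum_apply, Pi.single_apply]

theorem pw_le_pw_add_single (k : MIdx d) (j : Fin (d + 1)) : pw k ≤ pw (k + Pi.single j 1) := by
  rw [pw_add]; omega

theorem HasLineDerivAt.hasDerivAt_comp_add_smul {E : Type*} [AddCommGroup E] [Module ℝ E]
    {F : E → ℝ} {F' : ℝ} {x v : E} {t : ℝ} (h : HasLineDerivAt ℝ F F' (x + t • v) v) :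
    HasDerivAt (fun s : ℝ => F (x + s • v)) F' t := by
  have h₁ : HasDerivAt (fun s : ℝ => F (x + t • v + s • v)) F' (t - t) := by
    rw [sub_self]; exact h
  have h₂ := h₁.comp_sub_const t t
  refine h₂.congr_of_eventuallyEq (Filter.Eventually.of_forall fun s => ?_)
  simp only [add_assoc, ← add_smul]
  congr 3; ring

theorem hasLineDerivAt_integral_mul {f : Pt d → ℝ} (hf : Continuous f) (hc : HasCompactSupport f)
    {F F' : Pt d → Pt d → ℝ} {v : Pt d} {b : ℝ} (hF : ∀ w, Continuous fun z => F z w)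
    (hF' : ∀ w, Continuous fun z => F' z w) (hb : ∀ z w, |F' z w| ≤ b)
    (h : ∀ z w, HasLineDerivAt ℝ (fun w => F z w) (F' z w) w v) (w : Pt d) :
    HasLineDerivAt ℝ (fun w => ∫ z, f z * F z w) (∫ z, f z * F' z w) w v := by
  have hint : ∀ g : Pt d → ℝ, Continuous g → Integrable fun z => f z * g z := fun g hg =>
    (hf.mul hg).integrable_of_hasCompactSupport hc.mul_right
  have key := (hasDerivAt_integral_of_dominated_loc_of_deriv_le (μ := (volume : Measure (Pt d)))
    (F := fun (t : ℝ) z => f z * F z (w + t • v)) (F' := fun (t : ℝ) z => f z * F' z (w + t • v))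
    (x₀ := (0 : ℝ)) (s := Set.univ) (bound := fun z => |f z| * b) Filter.univ_mem
    (Filter.Eventually.of_forall fun t => (hint _ (hF (w + t • v))).aestronglyMeasurable)
    (hint _ (hF (w + (0 : ℝ) • v))) (hint _ (hF' (w + (0 : ℝ) • v))).aestronglyMeasurable
    (Filter.Eventually.of_forall fun z t _ => by
      rw [norm_mul, Real.norm_eq_abs, Real.norm_eq_abs]
      exact mul_le_mul_of_nonneg_left (hb _ _) (abs_nonneg _))
    ((hf.integrable_of_hasCompactSupport hc).abs.mul_const b)
    (Filter.Eventually.of_forall fun z t _ =>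
      ((h z (w + t • v)).hasDerivAt_comp_add_smul).const_mul (f z))).2
  rw [zero_smul, add_zero] at key
  exact key

theorem lineDerivIter_map_pdir {R : ℝ} {ψ : MIdx d → Pt d → ℝ}
    (h : ∀ (k : MIdx d) (j : Fin (d + 1)), (pw (k + Pi.single j 1) : ℝ) < R →
      ∀ w, HasLineDerivAt ℝ (ψ k) (ψ (k + Pi.single j 1) w) w (pdir d j))
    (L : List (Fin (d + 1))) (hL : (pw (L.map fun j => (Pi.single j 1 : MIdx d)).sum : ℝ) < R) :
    lineDerivIter (ψ 0) (L.map (pdir d)) = ψ (L.map fun j => (Pi.single j 1 : MIdx d)).sum := by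
  induction L with
  | nil => rfl
  | cons j L ih =>
    simp only [List.map_cons, List.sum_cons] at hL ⊢
    rw [add_comm (Pi.single j 1)] at hL ⊢
    have h₁ : (pw (L.map fun j => (Pi.single j 1 : MIdx d)).sum : ℝ) < R := by
      refine lt_of_le_of_lt ?_ hL
      exact_mod_cast pw_le_pw_add_single _ _
    ext w
    rw [lineDerivIter]
    have h₂ := ih h₁
    have h₃ : (fun w => lineDerivIter (ψ 0) (L.map (pdir d)) w) =
        ψ (L.map fun j => (Pi.single j 1 : MIdx d)).sum := h₂
    rw [h₃]
    exact (h _ j hL w).lineDeriv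

theorem pD_eq {R : ℝ} {ψ : MIdx d → Pt d → ℝ}
    (h : ∀ (k : MIdx d) (j : Fin (d + 1)), (pw (k + Pi.single j 1) : ℝ) < R →
      ∀ w, HasLineDerivAt ℝ (ψ k) (ψ (k + Pi.single j 1) w) w (pdir d j))
    {k : MIdx d} (hk : k ∈ idxSet d R) : pD k (ψ 0) = ψ k := by
  have h₁ : (((List.finRange (d + 1)).flatMap fun i => List.replicate (k i) i).map
      fun j => (Pi.single j 1 : MIdx d)).sum = k := by
    rw [List.map_flatMap, List.flatMap, List.sum_flatten, List.map_map]
    have : (List.sum ∘ fun i => List.map (fun j => (Pi.single j 1 : MIdx d))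
        (List.replicate (k i) i)) = fun i => k i • Pi.single i 1 := by
      ext1 i
      simp [List.map_replicate, List.sum_replicate]
    rw [this, ← List.ofFn_eq_map, List.sum_ofFn]
    ext i
    simp [Finset.sum_apply, Pi.single_apply]
  have h₂ := lineDerivIter_map_pdir h
    ((List.finRange (d + 1)).flatMap fun i => List.replicate (k i) i)
    (by rw [h₁]; exact mem_idxSet.1 hk)
  rw [h₁, List.map_flatMap] at h₂
  simp only [List.map_replicate] at h₂
  exact h₂

theorem eq_zero_of_support {R ε : ℝ} {D : MIdx d → Pt d → Pt d → ℝ}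
    (hs : ∀ z w, ε < pdist z w → D 0 z w = 0)
    (hD : ∀ (k : MIdx d) (j : Fin (d + 1)), (pw (k + Pi.single j 1) : ℝ) < R → ∀ z w,
      HasLineDerivAt ℝ (fun w' => D k z w') (D (k + Pi.single j 1) z w) w (pdir d j))
    (k : MIdx d) : (pw k : ℝ) < R → ∀ z w, ε < pdist z w → D k z w = 0 := by
  induction k using midx_induction with
  | h₀ => exact fun _ => hs
  | h k j ih =>
    intro hk z w hzw
    have h₁ : (pw k : ℝ) < R := lt_of_le_of_lt (by exact_mod_cast pw_le_pw_add_single k j) hk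
    have hopen : IsOpen {w' : Pt d | ε < pdist z w'} := by
      simp only [pdist_comm z]
      exact isOpen_lt continuous_const (continuous_pdist_left z)
    have h₂ : (fun w' => D k z w') =ᶠ[nhds w] fun _ => 0 := by
      filter_upwards [hopen.mem_nhds hzw] with w' hw' using ih h₁ z w' hw'
    have h₃ := (hD k j hk z w).congr_of_eventuallyEq h₂.symm
    have h₄ : HasLineDerivAt ℝ (fun _ : Pt d => (0 : ℝ)) 0 w (pdir d j) :=
      hasDerivAt_const _ _
    exact h₃.unique h₄

end Derivatives

section Scaling

variable {d : ℕ}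

theorem two_rpow_neg_pow_mul (n m : ℕ) (β x : ℝ) :
    ((2 : ℝ) ^ (-(n : ℝ))) ^ m * (2 : ℝ) ^ ((n : ℝ) * ((m : ℝ) - β + x)) =
      (2 : ℝ) ^ ((n : ℝ) * x) * (2 : ℝ) ^ (-(n : ℝ) * β) := by
  rw [← Real.rpow_natCast, ← Real.rpow_mul (by norm_num), ← Real.rpow_add (by norm_num),
    ← Real.rpow_add (by norm_num)]
  congr 1; ring

theorem kernelBound_of_le {β R A B : ℝ} (hR : 0 < R) {n : ℕ} {D : MIdx d → Pt d → Pt d → ℝ}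
    (hsupp : ∀ z w : Pt d, (2 : ℝ) ^ (-(n : ℝ)) < pdist z w → D 0 z w = 0)
    (hderiv : ∀ (k : MIdx d) (j : Fin (d + 1)), (pw (k + Pi.single j 1) : ℝ) < R → ∀ z w,
      HasLineDerivAt ℝ (fun w' => D k z w') (D (k + Pi.single j 1) z w) w (pdir d j))
    (hcont : ∀ k ∈ idxSet d R, Continuous fun p : Pt d × Pt d => D k p.1 p.2)
    (hA : ∀ k ∈ idxSet d R, ∀ z w,
      |D k z w| ≤ A * 2 ^ ((n : ℝ) * (((d : ℝ) + 2) - β + (pw k : ℝ))))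
    (hAR : ∀ z w w', |D 0 z w - pTaylor R (fun k => D k z w') w w'| ≤
      A * 2 ^ ((n : ℝ) * (((d : ℝ) + 2) - β + R)) * pdist w w' ^ R)
    (hB : ∀ k₁ ∈ idxSet d R, ∀ k₂ ∈ idxSet d R, ∀ w : Pt d,
      |∫ z : Pt d, pmono k₁ (z - w) * D k₂ z w| ≤ B * 2 ^ (-(n : ℝ) * β))
    (hBR : ∀ k₁ ∈ idxSet d R, ∀ z' w : Pt d, 0 < pdist z' w → pdist z' w ≤ 1 →
      |∫ z : Pt d, pmono k₁ (z - z') * (D 0 z z' - pTaylor R (fun k => D k z w) z' w)| ≤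
        B * 2 ^ (-(n : ℝ) * β) * pdist z' w ^ R) :
    0 ≤ A ∧ 0 ≤ B ∧
      KernelBound R (2 ^ (-(n : ℝ))) ((A + B) * 2 ^ (-(n : ℝ) * β)) D := by
  have h₀ := zero_mem_idxSet (d := d) hR
  have hA₀ : 0 ≤ A := nonneg_of_mul_nonneg_left ((abs_nonneg _).trans (hA 0 h₀ 0 0))
    (by positivity)
  have hB₀ : 0 ≤ B := nonneg_of_mul_nonneg_left ((abs_nonneg _).trans (hB 0 h₀ 0 h₀ 0))
    (by positivity)
  have hAM : A * 2 ^ (-(n : ℝ) * β) ≤ (A + B) * 2 ^ (-(n : ℝ) * β) := by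
    gcongr; linarith
  have hBM : B * 2 ^ (-(n : ℝ) * β) ≤ (A + B) * 2 ^ (-(n : ℝ) * β) := by
    gcongr; linarith
  have hscale : ∀ x : ℝ, ((2 : ℝ) ^ (-(n : ℝ))) ^ (d + 2) *
      (2 : ℝ) ^ ((n : ℝ) * (((d : ℝ) + 2) - β + x)) =
      (2 : ℝ) ^ ((n : ℝ) * x) * (2 : ℝ) ^ (-(n : ℝ) * β) := fun x => by
    have := two_rpow_neg_pow_mul n (d + 2) β x
    push_cast at this
    exact this
  have hinv : ∀ x : ℝ, ((2 : ℝ) ^ (-(n : ℝ))) ^ x * (2 : ℝ) ^ ((n : ℝ) * x) = 1 := fun x => by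
    rw [← Real.rpow_mul (by norm_num), ← Real.rpow_add (by norm_num), neg_mul, neg_add_cancel,
      Real.rpow_zero]
  refine ⟨hA₀, hB₀, ?_, ?_, ?_, ?_, ?_, ?_⟩
  · exact fun k hk w => (hcont k hk).comp (Continuous.prodMk_left w)
  · exact fun k hk => eq_zero_of_support hsupp hderiv k (mem_idxSet.1 hk)
  · intro k hk z w
    refine le_trans ?_ hAM
    have h₁ := hinv (pw k : ℝ)
    rw [Real.rpow_natCast] at h₁
    calc ((2 : ℝ) ^ (-(n : ℝ))) ^ (d + 2 + pw k) * |D k z w|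
        ≤ ((2 : ℝ) ^ (-(n : ℝ))) ^ (d + 2 + pw k) *
          (A * 2 ^ ((n : ℝ) * (((d : ℝ) + 2) - β + (pw k : ℝ)))) := by
          gcongr; exact hA k hk z w
      _ = A * (((2 : ℝ) ^ (-(n : ℝ))) ^ pw k * (((2 : ℝ) ^ (-(n : ℝ))) ^ (d + 2) *
          2 ^ ((n : ℝ) * (((d : ℝ) + 2) - β + (pw k : ℝ))))) := by rw [pow_add]; ring
      _ = A * 2 ^ (-(n : ℝ) * β) := by rw [hscale, ← mul_assoc (_ ^ pw k), h₁, one_mul]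
  · intro z w w'
    calc _ ≤ ((2 : ℝ) ^ (-(n : ℝ))) ^ (d + 2) * ((2 : ℝ) ^ (-(n : ℝ))) ^ R *
          (A * 2 ^ ((n : ℝ) * (((d : ℝ) + 2) - β + R)) * pdist w w' ^ R) := by
          gcongr; exact hAR z w w'
      _ = A * (((2 : ℝ) ^ (-(n : ℝ))) ^ R * (((2 : ℝ) ^ (-(n : ℝ))) ^ (d + 2) *
          2 ^ ((n : ℝ) * (((d : ℝ) + 2) - β + R)))) * pdist w w' ^ R := by ring
      _ = A * 2 ^ (-(n : ℝ) * β) * pdist w w' ^ R := by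
          rw [hscale, ← mul_assoc (_ ^ R), hinv, one_mul]
      _ ≤ _ := mul_le_mul_of_nonneg_right hAM (Real.rpow_nonneg (pdist_nonneg _ _) _)
  · exact fun k₁ hk₁ k₂ hk₂ w => (hB k₁ hk₁ k₂ hk₂ w).trans hBM
  · exact fun k hk w w' h₁ h₂ => (hBR k hk w w' h₁ h₂).trans
      (mul_le_mul_of_nonneg_right hBM (Real.rpow_nonneg (pdist_nonneg _ _) _))

theorem testBound_rescale {R lam : ℝ} (hlam : 0 < lam) {φ : Pt d → ℝ} {Dφ : MIdx d → Pt d → ℝ}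
    (hφ : Continuous φ) (hb : ∀ k ∈ idxSet d R, ∀ z, |Dφ k z| ≤ 1)
    (hh : ∀ z w, |φ z - pTaylor R (fun k => Dφ k w) z w| ≤ pdist z w ^ R) (z₀ : Pt d) :
    TestBound R lam (lam ^ (d + 2))⁻¹
      (fun z => (lam ^ (d + 2))⁻¹ * φ (dil lam⁻¹ (z - z₀)))
      fun k w => (lam ^ (d + 2))⁻¹ * ((lam⁻¹) ^ pw k * (Dφ k (dil lam⁻¹ (w - z₀)) / kfac k)) := by
  refine ⟨?_, ?_, ?_⟩
  · have h : Continuous fun z : Pt d => dil lam⁻¹ (z - z₀) := by unfold dil; fun_prop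
    exact continuous_const.mul (hφ.comp h)
  · intro k hk w
    have h₁ : |Dφ k (dil lam⁻¹ (w - z₀)) / kfac k| ≤ 1 := by
      rw [abs_div, Nat.abs_cast]
      exact (div_le_self (abs_nonneg _) (one_le_kfac k)).trans (hb k hk _)
    rw [abs_mul, abs_mul, abs_of_pos (by positivity : 0 < (lam ^ (d + 2))⁻¹),
      abs_of_pos (by positivity : 0 < lam⁻¹ ^ pw k)]
    calc lam ^ pw k * ((lam ^ (d + 2))⁻¹ * (lam⁻¹ ^ pw k * |Dφ k (dil lam⁻¹ (w - z₀)) / kfac k|))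
        = (lam ^ (d + 2))⁻¹ * |Dφ k (dil lam⁻¹ (w - z₀)) / kfac k| := by
          rw [inv_pow]; field_simp
      _ ≤ (lam ^ (d + 2))⁻¹ := mul_le_of_le_one_right (by positivity) h₁
  · intro z w
    have h₁ : dil lam⁻¹ (z - z₀) - dil lam⁻¹ (w - z₀) = dil lam⁻¹ (z - w) := by
      rw [← dil_sub, sub_sub_sub_cancel_right]
    have h₂ : pdist (dil lam⁻¹ (z - z₀)) (dil lam⁻¹ (w - z₀)) = lam⁻¹ * pdist z w := by
      rw [pdist_dil (by positivity), ← pdist_sub_zero, sub_sub_sub_cancel_right, pdist_sub_zero]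
    have h₃ : (lam ^ (d + 2))⁻¹ * φ (dil lam⁻¹ (z - z₀)) - ∑ k ∈ idxSet d R,
        (lam ^ (d + 2))⁻¹ * (lam⁻¹ ^ pw k * (Dφ k (dil lam⁻¹ (w - z₀)) / kfac k)) *
          pmono k (z - w) = (lam ^ (d + 2))⁻¹ * (φ (dil lam⁻¹ (z - z₀)) -
        pTaylor R (fun k => Dφ k (dil lam⁻¹ (w - z₀))) (dil lam⁻¹ (z - z₀))
          (dil lam⁻¹ (w - z₀))) := by
      rw [mul_sub, pTaylor, Finset.mul_sum]
      congr 1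
      refine Finset.sum_congr rfl fun k _ => ?_
      rw [h₁, pmono_dil]; ring
    have h₄ := hh (dil lam⁻¹ (z - z₀)) (dil lam⁻¹ (w - z₀))
    rw [h₂, Real.mul_rpow (by positivity) (pdist_nonneg _ _), Real.inv_rpow hlam.le] at h₄
    have h₅ : 0 < lam ^ R := Real.rpow_pos_of_pos hlam R
    rw [h₃, abs_mul, abs_of_pos (by positivity : 0 < (lam ^ (d + 2))⁻¹)]
    calc _ ≤ lam ^ R * ((lam ^ (d + 2))⁻¹ * ((lam ^ R)⁻¹ * pdist z w ^ R)) := by gcongr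
      _ = _ := by field_simp

end Scaling

section Sum

theorem ENNReal.tsum_ite_le_tsum_nat_add {g : ℕ → ℝ≥0∞} {p : ℕ → Prop} {N : ℕ}
    (hN : ∀ m < N, ¬ p m) : (∑' n, if p n then g n else 0) ≤ ∑' m, g (m + N) := by
  rw [← Summable.sum_add_tsum_nat_add' (k := N) ENNReal.summable,
    Finset.sum_eq_zero fun n hn => if_neg (hN n (Finset.mem_range.1 hn)), zero_add]
  refine ENNReal.tsum_le_tsum fun m => ?_
  split_ifs
  · exact le_rfl
  · exact zero_le

theorem tsum_two_rpow_le {β lam : ℝ} (hβ : 0 < β) (hlam : 0 < lam) :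
    (∑' n : ℕ, if (2 : ℝ) ^ (-(n : ℝ)) < lam then
      ENNReal.ofReal ((2 : ℝ) ^ (-(n : ℝ) * β)) else 0) ≤
      ENNReal.ofReal (lam ^ β * (1 - (2 : ℝ) ^ (-β))⁻¹) := by
  have hex : ∃ n : ℕ, (2 : ℝ) ^ (-(n : ℝ)) < lam := by
    obtain ⟨n, hn⟩ := exists_pow_lt_of_lt_one hlam (by norm_num : (1 / 2 : ℝ) < 1)
    refine ⟨n, ?_⟩
    rwa [Real.rpow_neg (by norm_num), Real.rpow_natCast, ← inv_pow, ← one_div]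
  obtain ⟨N, hNlt, hNmin⟩ : ∃ N : ℕ, (2 : ℝ) ^ (-(N : ℝ)) < lam ∧
      ∀ m < N, ¬ (2 : ℝ) ^ (-(m : ℝ)) < lam :=
    ⟨Nat.find hex, Nat.find_spec hex, fun m hm => Nat.find_min hex hm⟩
  have hr : (2 : ℝ) ^ (-β) < 1 := Real.rpow_lt_one_of_one_lt_of_neg (by norm_num) (by linarith)
  have hr₀ : 0 < (2 : ℝ) ^ (-β) := by positivity
  have hterm : ∀ m : ℕ, (2 : ℝ) ^ (-((m + N : ℕ) : ℝ) * β) =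
      (2 : ℝ) ^ (-(N : ℝ) * β) * ((2 : ℝ) ^ (-β)) ^ m := fun m => by
    rw [← Real.rpow_natCast, ← Real.rpow_mul (by norm_num), ← Real.rpow_add (by norm_num)]
    congr 1; push_cast; ring
  have hgeo : HasSum (fun m : ℕ => (2 : ℝ) ^ (-((m + N : ℕ) : ℝ) * β))
      ((2 : ℝ) ^ (-(N : ℝ) * β) * (1 - (2 : ℝ) ^ (-β))⁻¹) := by
    simp only [hterm]
    exact (hasSum_geometric_of_lt_one hr₀.le hr).mul_left _
  refine (ENNReal.tsum_ite_le_tsum_nat_add hNmin).trans ?_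
  rw [← ENNReal.ofReal_tsum_of_nonneg (fun _ => by positivity) hgeo.summable, hgeo.tsum_eq]
  refine ENNReal.ofReal_le_ofReal (mul_le_mul_of_nonneg_right ?_ (inv_nonneg.2 (by linarith)))
  rw [Real.rpow_mul (by norm_num)]
  exact Real.rpow_le_rpow (by positivity) hNlt.le hβ.le

end Sum

section Norm

variable {d : ℕ}

theorem BnormE_le_ofReal {R ρ G : ℝ} {z₀ : Pt d} {ψ : Pt d → ℝ} (hR : 0 < R) (hG : 0 ≤ G)
    (hsupp : ∀ w, ρ < pdist w z₀ → ψ w = 0)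
    (hsup : ∀ k ∈ idxSet d R, ∀ w, ρ ^ (d + 2 + pw k) * |pD k ψ w| ≤ G)
    (hholder : ∀ w w', 0 < pdist w w' → ρ ^ (((d : ℝ) + 2) + R) *
      |ψ w - pTaylor R (fun k => pD k ψ w') w w'| ≤ G * pdist w w' ^ R) :
    BnormE R ρ z₀ ψ ≤ ENNReal.ofReal (2 * G) := by
  rw [BnormE, if_pos hsupp, two_mul, ENNReal.ofReal_add hG hG]
  gcongr
  · exact iSup₂_le fun k hk => iSup_le fun w => ENNReal.ofReal_le_ofReal (hsup k hk w)
  · refine iSup₂_le fun w w' => ENNReal.ofReal_le_ofReal ?_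
    rcases (pdist_nonneg w w').eq_or_lt with h | h
    · rw [← h, Real.zero_rpow hR.ne', div_zero, mul_zero]; exact hG
    · rw [← mul_div_assoc, div_le_iff₀ (Real.rpow_pos_of_pos h R)]
      exact hholder w w' h

theorem exists_BnormE_integral_le (d : ℕ) {R : ℝ} (hR : 0 < R) :
    ∃ C : ℝ, 0 ≤ C ∧ ∀ (ε M lam : ℝ) (D : MIdx d → Pt d → Pt d → ℝ) (f : Pt d → ℝ)
      (a : MIdx d → Pt d → ℝ) (z₀ : Pt d), 0 < ε → ε ≤ lam → lam ≤ 1 → KernelBound R ε M D →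
      (∀ (k : MIdx d) (j : Fin (d + 1)), (pw (k + Pi.single j 1) : ℝ) < R → ∀ z w,
        HasLineDerivAt ℝ (fun w' => D k z w') (D (k + Pi.single j 1) z w) w (pdir d j)) →
      TestBound R lam (lam ^ (d + 2))⁻¹ f a → (∀ z, lam < pdist z z₀ → f z = 0) →
      BnormE R (2 * lam) z₀ (fun w => ∫ z, f z * D 0 z w) ≤ ENNReal.ofReal (C * M) := by
  obtain ⟨C, hC, h⟩ := exists_holder_bound d hR
  refine ⟨2 * (2 ^ (((d : ℝ) + 2) + R) * C), by positivity, ?_⟩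
  intro ε M lam D f a z₀ hε hεlam hlam hK hD hf hfs
  have hlam₀ : 0 < lam := hε.trans_le hεlam
  have hM := hK.nonneg hR
  obtain ⟨hsup, hholder⟩ := h ε M lam _ D f a hε hεlam hlam hK hf
  have hcs : HasCompactSupport f :=
    HasCompactSupport.intro (isCompact_pdist_le z₀ lam) fun z hz => hfs z (not_le.1 hz)
  have hderiv : ∀ (k : MIdx d) (j : Fin (d + 1)), (pw (k + Pi.single j 1) : ℝ) < R → ∀ w,
      HasLineDerivAt ℝ (fun w => ∫ z, f z * D k z w) (∫ z, f z * D (k + Pi.single j 1) z w) w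
        (pdir d j) := fun k j hkj w => by
    have hk : k ∈ idxSet d R :=
      mem_idxSet.2 (lt_of_le_of_lt (by exact_mod_cast pw_le_pw_add_single k j) hkj)
    refine hasLineDerivAt_integral_mul hf.cont hcs (hK.cont k hk)
      (hK.cont _ (mem_idxSet.2 hkj)) (b := M / ε ^ (d + 2 + pw (k + Pi.single j 1)))
      (fun z w => ?_) (hD k j hkj) w
    rw [le_div_iff₀ (by positivity), mul_comm]
    exact hK.bound _ (mem_idxSet.2 hkj) z w
  have hpD : ∀ k ∈ idxSet d R, pD k (fun w => ∫ z, f z * D 0 z w) =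
      fun w => ∫ z, f z * D k z w := fun k hk =>
    pD_eq (ψ := fun k w => ∫ z, f z * D k z w) hderiv hk
  rw [mul_assoc 2]
  refine BnormE_le_ofReal hR (by positivity) (fun w hw => ?_) (fun k hk w => ?_)
    fun w w' hw => ?_
  · refine integral_eq_zero_of_ae (Filter.Eventually.of_forall fun z => ?_)
    rcases lt_or_ge lam (pdist z z₀) with hz | hz
    · simp only [hfs z hz, zero_mul, Pi.zero_apply]
    · have h₁ := pdist_triangle w z z₀
      rw [pdist_comm w z] at h₁
      simp only [hK.supp 0 (zero_mem_idxSet hR) z w (by linarith), mul_zero, Pi.zero_apply]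
  · rw [hpD k hk]
    have h₁ : (2 : ℝ) ^ (d + 2 + pw k) ≤ 2 ^ (((d : ℝ) + 2) + R) := by
      rw [← Real.rpow_natCast]
      refine Real.rpow_le_rpow_of_exponent_le (by norm_num) ?_
      have := mem_idxSet.1 hk
      push_cast; linarith
    calc (2 * lam) ^ (d + 2 + pw k) * |∫ z, f z * D k z w|
        = 2 ^ (d + 2 + pw k) * (lam ^ (d + 2) * (lam ^ pw k * |∫ z, f z * D k z w|)) := by
          rw [mul_pow, pow_add lam]; ring
      _ ≤ 2 ^ (((d : ℝ) + 2) + R) * (lam ^ (d + 2) * (C * (M * (lam ^ (d + 2))⁻¹))) := by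
          gcongr ?_ * (_ * ?_); exact hsup k hk w
      _ = 2 ^ (((d : ℝ) + 2) + R) * C * M := by field_simp
  · have h₁ : pTaylor R (fun k => pD k (fun w => ∫ z, f z * D 0 z w) w') w w' =
        pTaylor R (fun k => ∫ z, f z * D k z w') w w' :=
      Finset.sum_congr rfl fun k hk => by beta_reduce; rw [hpD k hk]
    have h₂ : lam ^ (((d : ℝ) + 2) + R) = lam ^ (d + 2) * lam ^ R := by
      rw [Real.rpow_add hlam₀, ← Real.rpow_natCast lam (d + 2)]
      push_cast; rfl
    rw [h₁, Real.mul_rpow (by norm_num) hlam₀.le, h₂, mul_assoc, mul_assoc (lam ^ (d + 2))]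
    calc _ ≤ 2 ^ (((d : ℝ) + 2) + R) *
          (lam ^ (d + 2) * (C * (M * (lam ^ (d + 2))⁻¹) * pdist w w' ^ R)) := by
          gcongr _ * (_ * ?_); exact hholder w w' hw
      _ = _ := by field_simp

end Norm

theorem stmt12 (d : ℕ) (hd : 1 ≤ d) (β R : ℝ) (hβ₁ : 0 < β) (hβ₂ : β < (d : ℝ) + 2)
    (hR : 0 < R) (hRnotnat : ∀ n : ℕ, R ≠ n) :
    ∃ C : ℝ, 0 < C ∧
      ∀ (K : ℕ → Pt d → Pt d → ℝ) (DK : ℕ → MIdx d → Pt d → Pt d → ℝ) (A B : ℝ),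
        -- `K_n` (n ≥ 1) supported at parabolic distance ≤ 2^{-n} from the diagonal
        (∀ n : ℕ, 1 ≤ n → ∀ z w : Pt d, (2 : ℝ) ^ (-(n : ℝ)) < pdist z w → K n z w = 0) →
        -- `DK n` is the family of second-variable parabolic derivatives of `K_n`:
        (∀ (n : ℕ) (z w : Pt d), DK n 0 z w = K n z w) →
        (∀ n : ℕ, 1 ≤ n → ∀ (k : MIdx d) (j : Fin (d + 1)),
            (pw (k + Pi.single j 1) : ℝ) < R → ∀ z w : Pt d,
            HasLineDerivAt ℝ (fun w' => DK n k z w') (DK n (k + Pi.single j 1) z w) w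
              (pdir d j)) →
        -- ... these derivatives exist and are continuous for `|r|_s < R`
        (∀ n : ℕ, 1 ≤ n → ∀ k ∈ idxSet d R,
            Continuous fun p : Pt d × Pt d => DK n k p.1 p.2) →
        -- `‖{K_n}‖_{β;0,R} ≤ A`:
        (∀ n : ℕ, 1 ≤ n → ∀ k ∈ idxSet d R, ∀ z w : Pt d,
            |DK n k z w| ≤ A * 2 ^ ((n : ℝ) * (((d : ℝ) + 2) - β + (pw k : ℝ)))) →
        (∀ n : ℕ, 1 ≤ n → ∀ z w w' : Pt d,
            |K n z w - pTaylor R (fun k => DK n k z w') w w'| ≤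
              A * 2 ^ ((n : ℝ) * (((d : ℝ) + 2) - β + R)) * pdist w w' ^ R) →
        -- `⌈{K_n}⌉_{β;R} ≤ B`:
        (∀ n : ℕ, 1 ≤ n → ∀ k₁ ∈ idxSet d R, ∀ k₂ ∈ idxSet d R, ∀ w : Pt d,
            |∫ z : Pt d, pmono k₁ (z - w) * DK n k₂ z w| ≤ B * 2 ^ (-(n : ℝ) * β)) →
        (∀ n : ℕ, 1 ≤ n → ∀ k₁ ∈ idxSet d R, ∀ z' w : Pt d,
            0 < pdist z' w → pdist z' w ≤ 1 →
            |∫ z : Pt d, pmono k₁ (z - z') *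
                (K n z z' - pTaylor R (fun k => DK n k z w) z' w)| ≤
              B * 2 ^ (-(n : ℝ) * β) * pdist z' w ^ R) →
        -- test function `φ ∈ 𝔅_R`, given with its parabolic derivative family `Dφ`:
        ∀ (z₀ : Pt d) (φ : Pt d → ℝ) (Dφ : MIdx d → Pt d → ℝ),
          Continuous φ →
          (∀ z : Pt d, 1 < pdist z 0 → φ z = 0) →
          (∀ z : Pt d, Dφ 0 z = φ z) →
          (∀ (k : MIdx d) (j : Fin (d + 1)), (pw (k + Pi.single j 1) : ℝ) < R → ∀ z : Pt d,
              HasLineDerivAt ℝ (Dφ k) (Dφ (k + Pi.single j 1) z) z (pdir d j)) →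
          (∀ k ∈ idxSet d R, ∀ z : Pt d, |Dφ k z| ≤ 1) →
          (∀ z w : Pt d, |φ z - pTaylor R (fun k => Dφ k w) z w| ≤ pdist z w ^ R) →
          ∀ lam : ℝ, 0 < lam → lam < 1 →
            (∑' n : ℕ,
                if (2 : ℝ) ^ (-(n : ℝ)) < lam then
                  BnormE R (2 * lam) z₀ (fun w : Pt d =>
                    ∫ z : Pt d,
                      ((lam ^ (d + 2))⁻¹ *
                          φ (lam⁻¹ • (z.1 - z₀.1), (z.2 - z₀.2) / lam ^ 2)) * K n z w)
                else 0) ≤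
              ENNReal.ofReal (C * (A + B) * lam ^ β) := by
  obtain ⟨C, hC, hnorm⟩ := exists_BnormE_integral_le d hR
  have h₂β : (2 : ℝ) ^ (-β) < 1 :=
    Real.rpow_lt_one_of_one_lt_of_neg (by norm_num) (neg_neg_of_pos hβ₁)
  have hS : 0 ≤ (1 - (2 : ℝ) ^ (-β))⁻¹ := inv_nonneg.2 (by linarith)
  refine ⟨C * (1 - (2 : ℝ) ^ (-β))⁻¹ + 1, by positivity, ?_⟩
  intro K DK A B hsupp hDK hderiv hcont hA hAR hB hBR z₀ φ Dφ hφ hφs _ _ hφb hφh lam hlam hlam₁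
  have hkernel : ∀ n : ℕ, 1 ≤ n → 0 ≤ A ∧ 0 ≤ B ∧
      KernelBound R (2 ^ (-(n : ℝ))) ((A + B) * 2 ^ (-(n : ℝ) * β)) (DK n) := by
    simp only [← hDK] at hsupp hAR hBR
    exact fun n hn => kernelBound_of_le hR (hsupp n hn) (hderiv n hn) (hcont n hn) (hA n hn)
      (hAR n hn) (hB n hn) (hBR n hn)
  obtain ⟨hA₀, hB₀, -⟩ := hkernel 1 le_rfl
  have hf := testBound_rescale hlam hφ hφb hφh z₀
  have hfs : ∀ z, lam < pdist z z₀ → (lam ^ (d + 2))⁻¹ * φ (dil lam⁻¹ (z - z₀)) = 0 :=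
    fun z hz => by
      rw [hφs, mul_zero]
      rw [← dil_zero lam⁻¹, pdist_dil (by positivity), pdist_sub_zero, inv_mul_eq_div,
        one_lt_div hlam]
      exact hz
  have hdil : ∀ z : Pt d, ((lam⁻¹ • (z.1 - z₀.1), (z.2 - z₀.2) / lam ^ 2) : Pt d) =
      dil lam⁻¹ (z - z₀) := fun z => by
    simp only [dil, Prod.fst_sub, Prod.snd_sub, inv_pow, inv_mul_eq_div]
  simp only [hdil, ← hDK]
  calc _ ≤ ∑' n : ℕ, ENNReal.ofReal (C * (A + B)) * (if (2 : ℝ) ^ (-(n : ℝ)) < lam then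
        ENNReal.ofReal ((2 : ℝ) ^ (-(n : ℝ) * β)) else 0) := by
        refine ENNReal.tsum_le_tsum fun n => ?_
        split_ifs with hn
        · have hn₁ : 1 ≤ n := by
            rcases Nat.eq_zero_or_pos n with rfl | h
            · rw [Nat.cast_zero, neg_zero, Real.rpow_zero] at hn
              linarith
            · exact h
          rw [← ENNReal.ofReal_mul (by positivity), mul_assoc C]
          exact hnorm _ _ lam _ _ _ z₀ (by positivity) hn.le hlam₁.le (hkernel n hn₁).2.2
            (hderiv n hn₁) hf hfs
        · exact zero_le
    _ ≤ ENNReal.ofReal (C * (A + B)) * ENNReal.ofReal (lam ^ β * (1 - (2 : ℝ) ^ (-β))⁻¹) := by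
        rw [ENNReal.tsum_mul_left]
        exact mul_le_mul_right (tsum_two_rpow_le hβ₁ hlam) _
    _ ≤ _ := by
        rw [← ENNReal.ofReal_mul (by positivity)]
        refine ENNReal.ofReal_le_ofReal ?_
        have h : 0 ≤ (A + B) * lam ^ β := by positivity
        linarith
end
end
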